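/- For sufficiently large even n, let G = {G_1, ..., G_{n-1}} be a collection of n-1 graphs on a common vertex set V of size n with δ(G_i) ≥ (n-3)/2 for all i. If G contains no transversal Hamilton path, then either (a) there is an equitable partition A ∪ B of V such that every G_i is exactly the disjoint union of the complete graphs on A and on B, or (b) there is a set A ⊆ V with |A| = n/2 + 1 such that A is independent in every G_i. -/

import Mathlib

open SimpleGraph

/-- A transversal Hamilton path in a collection of `m` graphs on `V`. -/
def HasTransHamPath {V : Type*} [DecidableEq V] {m : ℕ} (Gs : Fin m → SimpleGraph V) : Prop :=
  ∃ (u v : V) (p : (⊤ : SimpleGraph V).Walk u v),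
    p.IsHamiltonian ∧
      ∃ φ : Fin p.edges.length ≃ Fin m, ∀ i, p.edges.get i ∈ (Gs (φ i)).edgeSet

/-- Degree of `v` in `G`, without decidability assumptions. -/
noncomputable def deg {V : Type*} (G : SimpleGraph V) (v : V) : ℕ :=
  (G.neighborSet v).ncard

/-- Rainbow path with given ends, vertex multiset and colour multiset. -/
inductive Pth {V C : Type} (G : C → SimpleGraph V) : V → V → Multiset V → Multiset C → Prop
  | single (u : V) : Pth G u u {u} 0
  | cons {u u' w : V} {S : Multiset V} {K : Multiset C} (c : C) (h : (G c).Adj u u')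
      (p : Pth G u' w S K) : Pth G u w ({u} + S) ({c} + K)

namespace Pth

variable {V C : Type} {G : C → SimpleGraph V}

theorem join {u w u' w' : V} {S S' : Multiset V} {K K' : Multiset C} (p : Pth G u w S K)
    (c : C) (h : (G c).Adj w u') (q : Pth G u' w' S' K') :
    Pth G u w' (S + S') (K + {c} + K') := by
  induction p with
  | single u => simpa using Pth.cons c h q
  | cons d h' p ih =>
    have := Pth.cons d h' (ih h)
    simpa only [add_assoc] using this

theorem symm {u w : V} {S : Multiset V} {K : Multiset C} (p : Pth G u w S K) :
    Pth G w u S K := by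
  induction p with
  | single u => exact Pth.single u
  | cons d h p ih =>
    have := ih.join d h.symm (Pth.single _)
    convert this using 1
    · exact add_comm _ _
    · simp [add_comm]

theorem toWalk {u w : V} {S : Multiset V} {K : Multiset C} (p : Pth G u w S K) :
    ∃ q : (⊤ : SimpleGraph V).Walk u w, (q.support : Multiset V) = S ∧
      ∃ cs : List C, (cs : Multiset C) = K ∧
        List.Forall₂ (fun e c => e ∈ (G c).edgeSet) q.edges cs := by
  induction p with
  | single u => exact ⟨.nil, rfl, [], rfl, by simp⟩
  | @cons u u' w S K c h p ih =>
    obtain ⟨q, hq, cs, hcs, hf⟩ := ih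
    refine ⟨.cons (show (⊤ : SimpleGraph V).Adj u u' from h.ne) q, ?_, c :: cs, ?_, ?_⟩
    · rw [← hq]; rfl
    · rw [← hcs]; rfl
    · rw [SimpleGraph.Walk.edges_cons]
      exact List.Forall₂.cons h hf

theorem ham [Fintype V] [DecidableEq V] {r : ℕ} {G : Fin r → SimpleGraph V} {u w : V}
    (p : Pth G u w Finset.univ.val Finset.univ.val) : HasTransHamPath G := by
  obtain ⟨q, hq, cs, hcs, hf⟩ := p.toWalk
  refine ⟨u, w, q, ?_, ?_⟩
  · intro a
    rw [← Multiset.coe_count, hq]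
    exact Multiset.count_univ a
  · have hnd : cs.Nodup := by
      rw [← Multiset.coe_nodup, hcs]; exact Finset.univ.nodup
    have hmem : ∀ c, c ∈ cs := by
      intro c
      rw [← Multiset.mem_coe, hcs]; exact Finset.mem_univ c
    have hlen := hf.length_eq
    refine ⟨(finCongr hlen).trans (hnd.getEquivOfForallMemList cs hmem), ?_⟩
    intro i
    have := hf.get i.2 (by rw [← hlen]; exact i.2)
    simpa using this

end Pth

/-- Multiset of the values of `f` on `[a,b)`. -/
def Rg {α : Type} (f : ℕ → α) (a b : ℕ) : Multiset α := ∑ i ∈ Finset.Ico a b, {f i}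

namespace Rg
variable {α : Type} {f g : ℕ → α}

theorem split (f : ℕ → α) {a b c : ℕ} (h : a ≤ b) (h' : b ≤ c) :
    Rg f a c = Rg f a b + Rg f b c := (Finset.sum_Ico_consecutive _ h h').symm

theorem one (f : ℕ → α) (a : ℕ) : Rg f a (a + 1) = {f a} := by simp [Rg]

theorem nil (f : ℕ → α) (a : ℕ) : Rg f a a = 0 := by simp [Rg]

theorem first (f : ℕ → α) {a b : ℕ} (h : a < b) : Rg f a b = {f a} + Rg f (a + 1) b := by
  rw [split f (Nat.le_succ a) h, one]

theorem last (f : ℕ → α) {a b : ℕ} (h : a ≤ b) : Rg f a (b + 1) = Rg f a b + {f b} := by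
  rw [split f h (Nat.le_succ b), one]

theorem congr {a b : ℕ} (h : ∀ i, a ≤ i → i < b → f i = g i) : Rg f a b = Rg g a b := by
  apply Finset.sum_congr rfl
  intro i hi
  rw [Finset.mem_Ico] at hi
  rw [h i hi.1 hi.2]

theorem reflect (f : ℕ → α) {a b N : ℕ} (h : b ≤ N + 1) :
    Rg (fun i => f (N - i)) a b = Rg f (N + 1 - b) (N + 1 - a) :=
  Finset.sum_Ico_reflect (fun i => ({f i} : Multiset α)) a h

theorem count_eq [DecidableEq α] (f : ℕ → α) (a b : ℕ) (y : α) :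
    (Rg f a b).count y = ((Finset.Ico a b).filter (fun i => f i = y)).card := by
  rw [Rg, Multiset.count_sum', Finset.card_filter]
  apply Finset.sum_congr rfl
  intro i _
  rw [Multiset.count_singleton]
  simp [eq_comm]

theorem countP_eq (p : α → Prop) [DecidablePred p] (f : ℕ → α) (a b : ℕ) :
    (Rg f a b).countP p = ((Finset.Ico a b).filter (fun i => p (f i))).card := by
  have : (Rg f a b).countP p = ∑ i ∈ Finset.Ico a b, ({f i} : Multiset α).countP p := by
    exact map_sum (Multiset.countPAddMonoidHom p) _ _
  rw [this, Finset.card_filter]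
  apply Finset.sum_congr rfl
  intro i _
  simp [Multiset.countP_eq_card_filter, Multiset.filter_singleton]
  split_ifs <;> simp

theorem mem_iff {a b : ℕ} {y : α} : y ∈ Rg f a b ↔ ∃ i, a ≤ i ∧ i < b ∧ f i = y := by
  rw [Rg, Multiset.mem_sum]
  simp [and_assoc, eq_comm]

end Rg

theorem Pth.blk {V C : Type} {G : C → SimpleGraph V} (v : ℕ → V) (c : ℕ → C) {a b : ℕ}
    (hab : a ≤ b) (h : ∀ i, a ≤ i → i < b → (G (c i)).Adj (v i) (v (i + 1))) :
    Pth G (v a) (v b) (Rg v a (b + 1)) (Rg c a b) := by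
  induction b, hab using Nat.le_induction with
  | base => rw [Rg.one, Rg.nil]; exact Pth.single _
  | succ b hab ih =>
    have := (ih fun i h1 h2 => h i h1 (by omega)).join (c b) (h b hab (by omega)) (Pth.single _)
    rw [Rg.last v (by omega), Rg.last c hab]
    simpa using this


section PStates
open scoped Classical

/-- The standing hypotheses. -/
structure Hyp {V C : Type} [Fintype V] [Fintype C] (G : C → SimpleGraph V) (m : ℕ) : Prop where
  cardV : Fintype.card V = 2 * m
  cardC : Fintype.card C + 1 = 2 * m
  big : 1000000000000 ≤ m
  dg : ∀ c u, m ≤ (Finset.univ.filter fun y => (G c).Adj u y).card + 1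
  noham : ∀ u w, ¬ Pth G u w Finset.univ.val Finset.univ.val

/-- A rainbow path missing one vertex and one colour. -/
structure PS {V C : Type} [Fintype V] [Fintype C] (G : C → SimpleGraph V) (m : ℕ) where
  v : ℕ → V
  c : ℕ → C
  x : V
  s : C
  adj : ∀ i, 1 ≤ i → i + 1 < 2 * m → (G (c i)).Adj (v i) (v (i + 1))
  hv : {x} + Rg v 1 (2 * m) = Finset.univ.val
  hc : {s} + Rg c 1 (2 * m - 1) = Finset.univ.val

namespace PS
variable {V C : Type} [Fintype V] [Fintype C] {G : C → SimpleGraph V} {m : ℕ}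

theorem cv (P : PS G m) (y : V) : (if y = P.x then 1 else 0) +
    ((Finset.Ico 1 (2 * m)).filter (fun i => P.v i = y)).card = 1 := by
  have h := congrArg (Multiset.count y) P.hv
  rw [Multiset.count_univ, Multiset.count_add, Rg.count_eq, Multiset.count_singleton] at h
  exact h

theorem cc (P : PS G m) (y : C) : (if y = P.s then 1 else 0) +
    ((Finset.Ico 1 (2 * m - 1)).filter (fun i => P.c i = y)).card = 1 := by
  have h := congrArg (Multiset.count y) P.hc
  rw [Multiset.count_univ, Multiset.count_add, Rg.count_eq, Multiset.count_singleton] at h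
  exact h

theorem vinj (P : PS G m) {i j : ℕ} (hi : 1 ≤ i) (hi' : i < 2 * m) (hj : 1 ≤ j)
    (hj' : j < 2 * m) (h : P.v i = P.v j) : i = j := by
  have h1 := P.cv (P.v i)
  have : ((Finset.Ico 1 (2 * m)).filter (fun k => P.v k = P.v i)).card ≤ 1 := by omega
  exact Finset.card_le_one.1 this i (by simp [hi, hi']) j (by simp [hj, hj', h])

theorem cinj (P : PS G m) {i j : ℕ} (hi : 1 ≤ i) (hi' : i + 1 < 2 * m) (hj : 1 ≤ j)
    (hj' : j + 1 < 2 * m) (h : P.c i = P.c j) : i = j := by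
  have h1 := P.cc (P.c i)
  have : ((Finset.Ico 1 (2 * m - 1)).filter (fun k => P.c k = P.c i)).card ≤ 1 := by omega
  exact Finset.card_le_one.1 this i (by simp [hi]; omega) j (by simp [hj, h]; omega)

theorem xne (P : PS G m) {i : ℕ} (hi : 1 ≤ i) (hi' : i < 2 * m) : P.v i ≠ P.x := by
  intro h
  have h1 := P.cv (P.v i)
  rw [if_pos h] at h1
  have : ((Finset.Ico 1 (2 * m)).filter (fun k => P.v k = P.v i)).card = 0 := by omega
  rw [Finset.card_eq_zero] at this
  have h2 : i ∈ ((Finset.Ico 1 (2 * m)).filter (fun k => P.v k = P.v i)) := by simp [hi, hi']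
  rw [this] at h2
  simp at h2

theorem vsurj (P : PS G m) (y : V) : y = P.x ∨ ∃ i, 1 ≤ i ∧ i < 2 * m ∧ P.v i = y := by
  have h : y ∈ {P.x} + Rg P.v 1 (2 * m) := by rw [P.hv]; exact Finset.mem_univ y
  rw [Multiset.mem_add, Rg.mem_iff, Multiset.mem_singleton] at h
  exact h

theorem csurj (P : PS G m) (y : C) : y = P.s ∨ ∃ i, 1 ≤ i ∧ i + 1 < 2 * m ∧ P.c i = y := by
  have h : y ∈ {P.s} + Rg P.c 1 (2 * m - 1) := by rw [P.hc]; exact Finset.mem_univ y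
  rw [Multiset.mem_add, Rg.mem_iff, Multiset.mem_singleton] at h
  rcases h with h | ⟨i, h1, h2, h3⟩
  · exact Or.inl h
  · exact Or.inr ⟨i, h1, by omega, h3⟩

theorem dgpos (H : Hyp G m) (P : PS G m) (c : C) (u : V) :
    m ≤ (if (G c).Adj u P.x then 1 else 0) +
      ((Finset.Ico 1 (2 * m)).filter (fun i => (G c).Adj u (P.v i))).card + 1 := by
  have h := H.dg c u
  have h2 : (Finset.univ.filter fun y => (G c).Adj u y).card =
      Multiset.countP (fun y => (G c).Adj u y) Finset.univ.val := by
    rw [Multiset.countP_eq_card_filter]; rfl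
  rw [h2, ← P.hv, Multiset.countP_add, Rg.countP_eq] at h
  have h3 : Multiset.countP (fun y => (G c).Adj u y) {P.x} =
      (if (G c).Adj u P.x then 1 else 0) := by
    simp [Multiset.countP_eq_card_filter, Multiset.filter_singleton]
    split_ifs <;> simp
  rw [h3] at h
  exact h

theorem dg2 (H : Hyp G m) (P : PS G m) (c : C) (u : V) :
    m ≤ ((Finset.Ico 1 (2 * m)).filter (fun i => (G c).Adj u (P.v i))).card + 2 := by
  have := P.dgpos H c u
  split_ifs at this <;> omega

theorem dgx (H : Hyp G m) (P : PS G m) (c : C) :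
    m ≤ ((Finset.Ico 1 (2 * m)).filter (fun i => (G c).Adj P.x (P.v i))).card + 1 := by
  have := P.dgpos H c P.x
  simpa using this

theorem blk (P : PS G m) {a b : ℕ} (ha : 1 ≤ a) (hab : a ≤ b) (hb : b < 2 * m) :
    Pth G (P.v a) (P.v b) (Rg P.v a (b + 1)) (Rg P.c a b) :=
  Pth.blk P.v P.c hab fun i h1 h2 => P.adj i (by omega) (by omega)

/-- Reversed state. -/
noncomputable def rev (P : PS G m) : PS G m where
  v := fun i => P.v (2 * m - i)
  c := fun i => P.c (2 * m - 1 - i)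
  x := P.x
  s := P.s
  adj := by
    intro i h1 h2
    have := P.adj (2 * m - 1 - i) (by omega) (by omega)
    rw [show 2 * m - 1 - i + 1 = 2 * m - i by omega] at this
    rw [show 2 * m - (i + 1) = 2 * m - 1 - i by omega]
    exact this.symm
  hv := by
    rw [Rg.reflect P.v (by omega), ← P.hv]
    congr 2 <;> omega
  hc := by
    rw [Rg.reflect P.c (by omega), ← P.hc]
    congr 2 <;> omega

/-- Rotated state. -/
noncomputable def rot (P : PS G m) (p : ℕ) (h1 : 1 ≤ p) (h2 : p + 1 < 2 * m)
    (h : (G P.s).Adj (P.v 1) (P.v (p + 1))) : PS G m where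
  v := fun i => if i ≤ p then P.v (p + 1 - i) else P.v i
  c := fun i => if i < p then P.c (p - i) else if i = p then P.s else P.c i
  x := P.x
  s := P.c p
  adj := by
    intro i hi hi'
    rcases lt_trichotomy i p with hlt | rfl | hgt
    · rw [if_pos hlt, if_pos hlt.le, if_pos (by omega)]
      have := P.adj (p - i) (by omega) (by omega)
      rw [show p - i + 1 = p + 1 - i by omega] at this
      rw [show p + 1 - (i + 1) = p - i by omega]
      exact this.symm
    · rw [if_neg (lt_irrefl _), if_pos rfl, if_pos le_rfl, if_neg (by omega)]
      rw [show i + 1 - i = 1 by omega]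
      exact h
    · rw [if_neg (by omega), if_neg (by omega), if_neg (by omega), if_neg (by omega)]
      exact P.adj i hi hi'
  hv := by
    rw [← P.hv]
    congr 1
    rw [Rg.split _ (show 1 ≤ p + 1 by omega) (show p + 1 ≤ 2 * m by omega),
      Rg.split P.v (show 1 ≤ p + 1 by omega) (show p + 1 ≤ 2 * m by omega)]
    congr 1
    · rw [Rg.congr (g := fun i => P.v (p + 1 - i)) (fun i h1 h2 => if_pos (by omega)),
        Rg.reflect P.v (by omega)]
      congr 1 <;> omega
    · exact Rg.congr fun i h1 h2 => if_neg (by omega)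
  hc := by
    rw [← P.hc]
    rw [Rg.split _ (show 1 ≤ p by omega) (show p ≤ 2 * m - 1 by omega),
      Rg.split P.c (show 1 ≤ p by omega) (show p ≤ 2 * m - 1 by omega),
      Rg.first _ (show p < 2 * m - 1 by omega), Rg.first P.c (show p < 2 * m - 1 by omega)]
    rw [Rg.congr (a := 1) (b := p) (g := fun i => P.c (p - i))
        (fun i h1 h2 => if_pos (by omega)), Rg.reflect P.c (by omega)]
    rw [Rg.congr (a := p + 1) (g := P.c) (fun i h1 h2 => by
        rw [if_neg (by omega), if_neg (by omega)])]
    rw [if_neg (lt_irrefl _), if_pos rfl]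
    rw [show p + 1 - p = 1 by omega, show p + 1 - 1 = p by omega]
    abel

/-- Swap the missing vertex with `v i`, using the missing colour to the left. -/
noncomputable def swapA (P : PS G m) (i : ℕ) (h1 : 2 ≤ i) (h2 : i < 2 * m)
    (ha : (G P.s).Adj P.x (P.v (i - 1)))
    (hb : i + 1 < 2 * m → (G (P.c i)).Adj P.x (P.v (i + 1))) : PS G m where
  v := fun j => if j = i then P.x else P.v j
  c := fun j => if j + 1 = i then P.s else P.c j
  x := P.v i
  s := P.c (i - 1)
  adj := by
    intro j hj hj'
    by_cases hji : j = i
    · subst hji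
      rw [if_neg (by omega), if_pos rfl, if_neg (by omega)]
      exact hb hj'
    · by_cases hji' : j + 1 = i
      · rw [if_pos hji', if_neg hji, if_pos hji']
        subst hji'
        exact ha.symm
      · rw [if_neg hji', if_neg hji, if_neg hji']
        exact P.adj j hj hj'
  hv := by
    rw [← P.hv]
    rw [Rg.split _ (show 1 ≤ i by omega) (show i ≤ 2 * m by omega),
      Rg.split P.v (show 1 ≤ i by omega) (show i ≤ 2 * m by omega),
      Rg.first _ h2, Rg.first P.v h2]
    rw [Rg.congr (a := 1) (g := P.v) (fun j h1 h2 => if_neg (by omega))]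
    rw [Rg.congr (a := i + 1) (g := P.v) (fun j h1 h2 => if_neg (by omega))]
    rw [if_pos rfl]
    abel
  hc := by
    obtain ⟨k, rfl⟩ : ∃ k, i = k + 1 := ⟨i - 1, by omega⟩
    rw [← P.hc]
    rw [Rg.split _ (show 1 ≤ k by omega) (show k ≤ 2 * m - 1 by omega),
      Rg.split P.c (show 1 ≤ k by omega) (show k ≤ 2 * m - 1 by omega),
      Rg.first _ (show k < 2 * m - 1 by omega), Rg.first P.c (show k < 2 * m - 1 by omega)]
    rw [Rg.congr (a := 1) (g := P.c) (fun j h1 h2 => if_neg (by omega))]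
    rw [Rg.congr (a := k + 1) (g := P.c) (fun j h1 h2 => if_neg (by omega))]
    rw [if_pos rfl, Nat.add_sub_cancel]
    abel

/-- Swap the missing vertex with `v i`, using the missing colour to the right. -/
noncomputable def swapB (P : PS G m) (i : ℕ) (h1 : 1 ≤ i) (h2 : i + 1 < 2 * m)
    (ha : 2 ≤ i → (G (P.c (i - 1))).Adj P.x (P.v (i - 1)))
    (hb : (G P.s).Adj P.x (P.v (i + 1))) : PS G m where
  v := fun j => if j = i then P.x else P.v j
  c := fun j => if j = i then P.s else P.c j
  x := P.v i
  s := P.c i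
  adj := by
    intro j hj hj'
    by_cases hji : j = i
    · subst hji
      rw [if_pos rfl, if_pos rfl, if_neg (by omega)]
      exact hb
    · by_cases hji' : j + 1 = i
      · rw [if_neg hji, if_neg hji, if_pos hji']
        subst hji'
        exact (ha (by omega)).symm
      · rw [if_neg hji', if_neg hji, if_neg hji]
        exact P.adj j hj hj'
  hv := by
    rw [← P.hv]
    rw [Rg.split _ (show 1 ≤ i by omega) (show i ≤ 2 * m by omega),
      Rg.split P.v (show 1 ≤ i by omega) (show i ≤ 2 * m by omega),
      Rg.first _ (show i < 2 * m by omega), Rg.first P.v (show i < 2 * m by omega)]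
    rw [Rg.congr (a := 1) (g := P.v) (fun j h1 h2 => if_neg (by omega))]
    rw [Rg.congr (a := i + 1) (g := P.v) (fun j h1 h2 => if_neg (by omega))]
    rw [if_pos rfl]
    abel
  hc := by
    rw [← P.hc]
    rw [Rg.split _ (show 1 ≤ i by omega) (show i ≤ 2 * m - 1 by omega),
      Rg.split P.c (show 1 ≤ i by omega) (show i ≤ 2 * m - 1 by omega),
      Rg.first _ (show i < 2 * m - 1 by omega), Rg.first P.c (show i < 2 * m - 1 by omega)]
    rw [Rg.congr (a := 1) (g := P.c) (fun j h1 h2 => if_neg (by omega))]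
    rw [Rg.congr (a := i + 1) (g := P.c) (fun j h1 h2 => if_neg (by omega))]
    rw [if_pos rfl]
    abel

end PS
end PStates


section TwoPaths
open scoped Classical
variable {V C : Type} [Fintype V] [Fintype C] {G : C → SimpleGraph V} {m : ℕ}

theorem Hyp.fin3 (H : Hyp G m) {u₁ w₁ u₂ w₂ u₃ w₃ : V} {S₁ S₂ S₃ : Multiset V}
    {K₁ K₂ K₃ : Multiset C} (q₁ : Pth G u₁ w₁ S₁ K₁) (q₂ : Pth G u₂ w₂ S₂ K₂)
    (q₃ : Pth G u₃ w₃ S₃ K₃) {c d : C} (h : (G c).Adj w₁ u₂) (h' : (G d).Adj w₂ u₃)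
    (hS : S₁ + S₂ + S₃ = Finset.univ.val)
    (hK : K₁ + K₂ + K₃ + {c} + {d} = Finset.univ.val) : False := by
  have h1 := (q₁.join c h q₂).join d h' q₃
  rw [hS, show K₁ + {c} + K₂ + {d} + K₃ = K₁ + K₂ + K₃ + {c} + {d} by abel, hK] at h1
  exact H.noham _ _ h1

/-- Two paths covering everything with one missing colour. -/
structure TP (G : C → SimpleGraph V) (m : ℕ) (v : ℕ → V) (c : ℕ → C) (k l : ℕ)
    (W : ℕ → ℕ → Multiset V) (K : ℕ → ℕ → Multiset C) : Prop where
  hk : 1 ≤ k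
  hk' : k + 1 < 2 * m
  hl : 1 ≤ l
  hl' : l + 1 < 2 * m
  ne : l ≠ k
  blk : ∀ a b, 1 ≤ a → a ≤ b → b < 2 * m → Pth G (v a) (v b) (W a b) (K a b)
  spW : ∀ a p b, a ≤ p → p < b → p ≠ l → W a b = W a p + W (p + 1) b
  spK : ∀ a p b, a ≤ p → p < b → p ≠ l → K a b = K a p + K (p + 1) b + {c p}
  totW : W 1 k + W (k + 1) (2 * m - 1) = Finset.univ.val
  totK : K 1 k + K (k + 1) (2 * m - 1) + {c l} = Finset.univ.val

namespace PS

/-- `l` witnesses that `k` is accessible. -/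
def Link (P : PS G m) (k l : ℕ) : Prop :=
  1 ≤ l ∧ l + 1 < 2 * m ∧
    ((G P.s).Adj P.x (P.v l) ∧ (G (P.c k)).Adj P.x (P.v (l + 1)) ∨
      (G (P.c k)).Adj P.x (P.v l) ∧ (G P.s).Adj P.x (P.v (l + 1)))

/-- accessible index -/
def Acc (P : PS G m) (k : ℕ) : Prop := ∃ l, P.Link k l

theorem Link.through {P : PS G m} {k l : ℕ} (h : P.Link k l) {a b : ℕ} (ha : 1 ≤ a)
    (hal : a ≤ l) (hlb : l < b) (hb : b < 2 * m) :
    Pth G (P.v a) (P.v b) (Rg P.v a (b + 1) + {P.x})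
      (Rg P.c a l + Rg P.c (l + 1) b + {P.s} + {P.c k}) := by
  obtain ⟨_, _, h⟩ := h
  have q₁ := P.blk ha hal (by omega)
  have q₂ := P.blk (a := l + 1) (by omega) (show l + 1 ≤ b by omega) hb
  rw [Rg.split P.v (show a ≤ l + 1 by omega) (show l + 1 ≤ b + 1 by omega)]
  rcases h with ⟨h1, h2⟩ | ⟨h1, h2⟩
  · convert (q₁.join _ h1.symm (Pth.single P.x)).join _ h2 q₂ using 1
    · abel
    · simp only [add_zero]; abel
  · convert (q₁.join _ h1.symm (Pth.single P.x)).join _ h2 q₂ using 1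
    · abel
    · simp only [add_zero]; abel

theorem Link.ne {P : PS G m} (H : Hyp G m) {k l : ℕ} (h : P.Link k l) : l ≠ k := by
  rintro rfl
  have h1 := h.1
  have h2 := h.2.1
  have q := h.through (a := 1) (b := 2 * m - 1) le_rfl h1 (by omega) (by omega)
  refine H.noham (P.v 1) (P.v (2 * m - 1)) ?_
  convert q using 1
  · rw [← P.hv, show 2 * m - 1 + 1 = 2 * m by omega, add_comm]
  · rw [← P.hc, Rg.split P.c h1 (show l ≤ 2 * m - 1 by omega),
      Rg.first P.c (show l < 2 * m - 1 by omega)]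
    abel

theorem Link.tp {P : PS G m} (H : Hyp G m) {k l : ℕ} (hk : 1 ≤ k) (hk' : k + 1 < 2 * m)
    (h : P.Link k l) : ∃ W K, TP G m P.v P.c k l W K := by
  have h1 := h.1
  have h2 := h.2.1
  have hne := h.ne H
  refine ⟨fun a b => Rg P.v a (b + 1) + if a ≤ l ∧ l < b then {P.x} else 0,
    fun a b => if a ≤ l ∧ l < b then Rg P.c a l + Rg P.c (l + 1) b + {P.s} + {P.c k}
      else Rg P.c a b, hk, hk', h1, h2, hne, ?_, ?_, ?_, ?_, ?_⟩
  · intro a b ha hab hb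
    split_ifs with hc
    · exact h.through ha hc.1 hc.2 hb
    · rw [add_zero]; exact P.blk ha hab hb
  · intro a p b hap hpb hpl
    rw [Rg.split P.v (show a ≤ p + 1 by omega) (show p + 1 ≤ b + 1 by omega)]
    rcases lt_or_gt_of_ne hpl with hlt | hgt
    · rw [if_neg (show ¬ (a ≤ l ∧ l < p) by omega)]
      by_cases hc : l < b
      · rw [if_pos (by omega), if_pos (by omega)]; abel
      · rw [if_neg (by omega), if_neg (by omega)]; abel
    · rw [if_neg (show ¬ (p + 1 ≤ l ∧ l < b) by omega)]
      by_cases hc : a ≤ l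
      · rw [if_pos (by omega), if_pos (by omega)]; abel
      · rw [if_neg (by omega), if_neg (by omega)]; abel
  · intro a p b hap hpb hpl
    rcases lt_or_gt_of_ne hpl with hlt | hgt
    · rw [if_neg (show ¬ (a ≤ l ∧ l < p) by omega)]
      by_cases hc : l < b
      · rw [if_pos (by omega), if_pos (by omega)]
        rw [Rg.split P.c hap (show p ≤ l by omega), Rg.first P.c hlt]; abel
      · rw [if_neg (by omega), if_neg (by omega)]
        rw [Rg.split P.c hap (show p ≤ b by omega), Rg.first P.c hpb]; abel
    · rw [if_neg (show ¬ (p + 1 ≤ l ∧ l < b) by omega)]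
      by_cases hc : a ≤ l
      · rw [if_pos (by omega), if_pos (by omega)]
        rw [Rg.split P.c (show l + 1 ≤ p by omega) (show p ≤ b by omega), Rg.first P.c hpb]; abel
      · rw [if_neg (by omega), if_neg (by omega)]
        rw [Rg.split P.c hap (show p ≤ b by omega), Rg.first P.c hpb]; abel
  · skip
    rw [← P.hv, show 2 * m - 1 + 1 = 2 * m by omega,
      Rg.split P.v (show 1 ≤ k + 1 by omega) (show k + 1 ≤ 2 * m by omega)]
    rcases lt_or_gt_of_ne hne with hlt | hgt
    · rw [if_pos (by omega), if_neg (by omega)]; abel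
    · rw [if_neg (by omega), if_pos (by omega)]; abel
  · skip
    rw [← P.hc, Rg.split P.c hk (show k ≤ 2 * m - 1 by omega),
      Rg.first P.c (show k < 2 * m - 1 by omega)]
    rcases lt_or_gt_of_ne hne with hlt | hgt
    · rw [if_pos (by omega), if_neg (by omega)]
      rw [Rg.split P.c h1 hlt.le, Rg.first P.c hlt]; abel
    · rw [if_neg (by omega), if_pos (by omega)]
      rw [Rg.split P.c (show k + 1 ≤ l by omega) (show l ≤ 2 * m - 1 by omega),
        Rg.first P.c (show l < 2 * m - 1 by omega)]; abel

end PS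

namespace TP
variable {v : ℕ → V} {c : ℕ → C} {k l : ℕ} {W : ℕ → ℕ → Multiset V} {K : ℕ → ℕ → Multiset C}

theorem lo (Q : TP G m v c k l W K) {p : ℕ} (hp : 1 ≤ p) (hpk : p < k) (hpl : p ≠ l) :
    W 1 p + W (p + 1) k + W (k + 1) (2 * m - 1) = Finset.univ.val ∧
    K 1 p + K (p + 1) k + K (k + 1) (2 * m - 1) + {c p} + {c l} = Finset.univ.val := by
  rw [← Q.totW, ← Q.totK, Q.spW 1 p k hp hpk hpl, Q.spK 1 p k hp hpk hpl]
  constructor <;> abel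

theorem hi (Q : TP G m v c k l W K) {p : ℕ} (hkp : k < p) (hp : p + 1 < 2 * m) (hpl : p ≠ l) :
    W 1 k + W (k + 1) p + W (p + 1) (2 * m - 1) = Finset.univ.val ∧
    K 1 k + K (k + 1) p + K (p + 1) (2 * m - 1) + {c p} + {c l} = Finset.univ.val := by
  rw [← Q.totW, ← Q.totK, Q.spW (k + 1) p (2 * m - 1) hkp (by omega) hpl,
    Q.spK (k + 1) p (2 * m - 1) hkp (by omega) hpl]
  constructor <;> abel

/-- R1 -/
theorem r1 (H : Hyp G m) (Q : TP G m v c k l W K) {p : ℕ} (hp : 1 ≤ p) (hpk : p < k) (hpl : p ≠ l)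
    (h1 : (G (c p)).Adj (v p) (v k)) (h2 : (G (c l)).Adj (v (2 * m - 1)) (v (p + 1))) : False := by
  have hk := Q.hk'
  obtain ⟨hW, hK⟩ := Q.lo hp hpk hpl
  exact H.fin3 (Q.blk 1 p le_rfl hp (by omega)) (Q.blk (p + 1) k (by omega) (by omega) (by omega)).symm
    (Q.blk (k + 1) (2 * m - 1) (by omega) (by omega) (by omega)).symm h1 h2.symm
    (by rw [← hW]) (by rw [← hK])

theorem r1' (H : Hyp G m) (Q : TP G m v c k l W K) {p : ℕ} (hkp : k < p) (hp : p + 1 < 2 * m)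
    (hpl : p ≠ l)
    (h1 : (G (c p)).Adj (v (p + 1)) (v k)) (h2 : (G (c l)).Adj (v (2 * m - 1)) (v p)) : False := by
  have hk := Q.hk
  obtain ⟨hW, hK⟩ := Q.hi hkp hp hpl
  exact H.fin3 (Q.blk 1 k le_rfl hk (by omega))
    (Q.blk (p + 1) (2 * m - 1) (by omega) (by omega) (by omega))
    (Q.blk (k + 1) p (by omega) (by omega) (by omega)).symm h1.symm h2
    (by rw [← hW]; abel) (by rw [← hK]; abel)

theorem r2 (H : Hyp G m) (Q : TP G m v c k l W K) {p : ℕ} (hp : 1 ≤ p) (hp' : p + 1 < 2 * m)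
    (hpl : p ≠ l) (hpk : p ≠ k)
    (h1 : (G (c p)).Adj (v (p + 1)) (v 1)) (h2 : (G (c l)).Adj (v (2 * m - 1)) (v p)) : False := by
  have hk := Q.hk
  have hk' := Q.hk'
  rcases lt_or_gt_of_ne hpk with hpk | hpk
  · obtain ⟨hW, hK⟩ := Q.lo hp hpk hpl
    exact H.fin3 (Q.blk (k + 1) (2 * m - 1) (by omega) (by omega) (by omega))
      (Q.blk 1 p le_rfl hp (by omega)).symm (Q.blk (p + 1) k (by omega) (by omega) (by omega))
      h2 h1.symm (by rw [← hW]; abel) (by rw [← hK]; abel)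
  · obtain ⟨hW, hK⟩ := Q.hi hpk hp' hpl
    exact H.fin3 (Q.blk 1 k le_rfl hk (by omega)).symm
      (Q.blk (p + 1) (2 * m - 1) (by omega) (by omega) (by omega))
      (Q.blk (k + 1) p (by omega) (by omega) (by omega)).symm h1.symm h2
      (by rw [← hW]; abel) (by rw [← hK]; abel)

theorem r3 (H : Hyp G m) (Q : TP G m v c k l W K) {p : ℕ} (hp : 1 ≤ p) (hp' : p + 1 < 2 * m)
    (hpl : p ≠ l) (hpk : p ≠ k)
    (h1 : (G (c p)).Adj (v (p + 1)) (v (k + 1))) (h2 : (G (c l)).Adj (v k) (v p)) : False := by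
  have hk := Q.hk
  have hk' := Q.hk'
  rcases lt_or_gt_of_ne hpk with hpk | hpk
  · obtain ⟨hW, hK⟩ := Q.lo hp hpk hpl
    exact H.fin3 (Q.blk 1 p le_rfl hp (by omega))
      (Q.blk (p + 1) k (by omega) (by omega) (by omega)).symm
      (Q.blk (k + 1) (2 * m - 1) (by omega) (by omega) (by omega))
      h2.symm h1 (by rw [← hW]) (by rw [← hK]; abel)
  · obtain ⟨hW, hK⟩ := Q.hi hpk hp' hpl
    exact H.fin3 (Q.blk 1 k le_rfl hk (by omega))
      (Q.blk (k + 1) p (by omega) (by omega) (by omega)).symm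
      (Q.blk (p + 1) (2 * m - 1) (by omega) (by omega) (by omega)) h2 h1.symm
      (by rw [← hW]) (by rw [← hK]; abel)

theorem ca (H : Hyp G m) (Q : TP G m v c k l W K) {p : ℕ} (hp : 1 ≤ p) (hpk : p < k) (hpl : p ≠ l)
    (h1 : (G (c l)).Adj (v 1) (v (p + 1))) (h2 : (G (c p)).Adj (v (2 * m - 1)) (v k)) : False := by
  have hk' := Q.hk'
  obtain ⟨hW, hK⟩ := Q.lo hp hpk hpl
  exact H.fin3 (Q.blk 1 p le_rfl hp (by omega)).symm
    (Q.blk (p + 1) k (by omega) (by omega) (by omega))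
    (Q.blk (k + 1) (2 * m - 1) (by omega) (by omega) (by omega)).symm
    h1 h2.symm (by rw [← hW]) (by rw [← hK]; abel)

theorem cb (H : Hyp G m) (Q : TP G m v c k l W K) {p : ℕ} (hkp : k < p) (hp : p + 1 < 2 * m)
    (hpl : p ≠ l)
    (h1 : (G (c l)).Adj (v 1) (v (p + 1))) (h2 : (G (c p)).Adj (v (2 * m - 1)) (v p)) : False := by
  have hk := Q.hk
  obtain ⟨hW, hK⟩ := Q.hi hkp hp hpl
  exact H.fin3 (Q.blk 1 k le_rfl hk (by omega)).symm
    (Q.blk (p + 1) (2 * m - 1) (by omega) (by omega) (by omega))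
    (Q.blk (k + 1) p (by omega) (by omega) (by omega)).symm h1 h2
    (by rw [← hW]; abel) (by rw [← hK]; abel)

theorem ccc (H : Hyp G m) (Q : TP G m v c k l W K) {p r : ℕ} (hkr : k < r) (hrp : r < p)
    (hp : p + 1 < 2 * m) (hpl : p ≠ l) (hrl : r ≠ l)
    (h1 : (G (c l)).Adj (v 1) (v (p + 1))) (h2 : (G (c p)).Adj (v (2 * m - 1)) (v r))
    (h3 : (G (c r)).Adj (v p) (v k)) : False := by
  have hk := Q.hk
  obtain ⟨hW, hK⟩ := Q.hi (show k < p by omega) hp hpl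
  rw [Q.spW (k + 1) r p hkr hrp hrl] at hW
  rw [Q.spK (k + 1) r p hkr hrp hrl] at hK
  have q := (Q.blk (r + 1) p (by omega) (by omega) (by omega)).join _ h3
    (Q.blk 1 k le_rfl hk (by omega)).symm
  exact H.fin3 q
    (Q.blk (p + 1) (2 * m - 1) (by omega) (by omega) (by omega))
    (Q.blk (k + 1) r (by omega) (by omega) (by omega)).symm h1 h2
    (by rw [← hW]; abel) (by rw [← hK]; abel)

end TP
end TwoPaths


section Evens
open scoped Classical

/-- even positions -/
def evs (m : ℕ) : Finset ℕ := (Finset.Ico 1 (2 * m)).filter Even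

theorem mem_evs {m q : ℕ} : q ∈ evs m ↔ (1 ≤ q ∧ q < 2 * m) ∧ Even q := by
  simp [evs]

theorem card_evs (m : ℕ) : (evs m).card = m - 1 := by
  have : evs m = (Finset.Ico 1 m).image (fun i => 2 * i) := by
    ext q
    rw [mem_evs, Finset.mem_image]
    constructor
    · rintro ⟨⟨h1, h2⟩, r, hr⟩
      exact ⟨r, by rw [Finset.mem_Ico]; omega, by omega⟩
    · rintro ⟨r, hr, rfl⟩
      rw [Finset.mem_Ico] at hr
      exact ⟨by omega, by simp⟩
  rw [this, Finset.card_image_of_injective _ (fun a b h => by simpa using h), Nat.card_Ico]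

theorem evens_of {m : ℕ} (hm : 3 ≤ m) (S X : Finset ℕ) (hS : ∀ s ∈ S, 2 ≤ s ∧ s + 1 < 2 * m)
    (hX : ∀ s ∈ X, 1 ≤ s ∧ s < 2 * m) (cS : m ≤ S.card + 1) (cX : m ≤ X.card + 1)
    (h1 : ∀ l, l ∈ S → l + 1 ∈ X → False) (h2 : ∀ l, l ∈ X → l + 1 ∈ S → False) :
    S = evs m ∧ X = evs m := by
  have hne : S.Nonempty := by
    rw [← Finset.card_pos]; omega
  obtain ⟨μ, hμ⟩ : ∃ μ, μ = S.min' hne := ⟨_, rfl⟩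
  have hμS : μ ∈ S := hμ ▸ S.min'_mem hne
  have hμle : ∀ s ∈ S, μ ≤ s := fun s hs => hμ ▸ S.min'_le s hs
  have hμ2 := hS μ hμS
  set T := insert (μ - 1) (S.image (· + 1)) with hT
  have hTc : T.card = S.card + 1 := by
    rw [hT, Finset.card_insert_of_notMem, Finset.card_image_of_injective _
      (add_left_injective 1)]
    intro h
    rw [Finset.mem_image] at h
    obtain ⟨a, ha, hb⟩ := h
    have := hμle a ha
    omega
  have hTX : Disjoint T X := by
    rw [Finset.disjoint_left]
    intro a ha haX
    rw [hT, Finset.mem_insert, Finset.mem_image] at ha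
    rcases ha with rfl | ⟨b, hb, rfl⟩
    · exact h2 (μ - 1) haX (by rw [Nat.sub_add_cancel (by omega)]; exact hμS)
    · exact h1 b hb haX
  have hsub : T ∪ X ⊆ Finset.Ico 1 (2 * m) := by
    intro a ha
    rw [Finset.mem_Ico]
    rw [Finset.mem_union, hT, Finset.mem_insert, Finset.mem_image] at ha
    rcases ha with (rfl | ⟨b, hb, rfl⟩) | ha
    · omega
    · have := hS b hb; omega
    · exact hX a ha
  have hcard := Finset.card_le_card hsub
  rw [Finset.card_union_of_disjoint hTX, Nat.card_Ico, hTc] at hcard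
  have heq : T ∪ X = Finset.Ico 1 (2 * m) := by
    apply Finset.eq_of_subset_of_card_le hsub
    rw [Finset.card_union_of_disjoint hTX, Nat.card_Ico, hTc]
    omega
  have hstep : ∀ s ∈ S, s = μ ∨ (2 ≤ s ∧ s - 2 ∈ S) := by
    intro s hs
    have hs2 := hS s hs
    have : s - 1 ∈ T ∪ X := by rw [heq, Finset.mem_Ico]; omega
    rw [Finset.mem_union, hT, Finset.mem_insert, Finset.mem_image] at this
    rcases this with (h | ⟨b, hb, hb'⟩) | h
    · left; omega
    · right; refine ⟨hs2.1, ?_⟩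
      rwa [show s - 2 = b by omega]
    · exact (h2 (s - 1) h (by rwa [Nat.sub_add_cancel (by omega)])).elim
  have hpar : ∀ s, s ∈ S → s % 2 = μ % 2 := by
    intro s
    induction s using Nat.strong_induction_on with
    | _ s ih =>
      intro hs
      rcases hstep s hs with rfl | ⟨h, h'⟩
      · rfl
      · have := ih (s - 2) (by omega) h'
        omega
  have hμe : μ % 2 = 0 := by
    by_contra hodd
    have : S.card ≤ (Finset.Ico 1 (m - 1)).card := by
      apply Finset.card_le_card_of_injOn (fun s => s / 2)
      · intro s hs
        have e1 := hpar s hs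
        have e2 := hS s hs
        simp only [Finset.coe_Ico, Set.mem_Ico]
        omega
      · intro a ha b hb hab
        have e1 := hpar a ha
        have e2 := hpar b hb
        simp only at hab
        omega
    rw [Nat.card_Ico] at this
    omega
  have hSe : S = evs m := by
    apply Finset.eq_of_subset_of_card_le
    · intro s hs
      have e1 := hpar s hs
      have e2 := hS s hs
      rw [mem_evs]
      exact ⟨by omega, Nat.even_iff.2 (by omega)⟩
    · rw [card_evs]; omega
  refine ⟨hSe, ?_⟩
  apply Finset.eq_of_subset_of_card_le
  · intro a ha
    have e := hX a ha
    rw [mem_evs]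
    refine ⟨e, ?_⟩
    by_contra hodd
    rw [Nat.not_even_iff_odd, Nat.odd_iff] at hodd
    by_cases ha1 : a = 1
    · refine h2 a ha ?_
      rw [hSe, mem_evs]
      exact ⟨by omega, Nat.even_iff.2 (by omega)⟩
    · refine h1 (a - 1) ?_ (by rwa [Nat.sub_add_cancel (by omega)])
      rw [hSe, mem_evs]
      exact ⟨by omega, Nat.even_iff.2 (by omega)⟩
  · rw [card_evs]; omega

variable {V C : Type} [Fintype V] [Fintype C] {G : C → SimpleGraph V} {m : ℕ}

namespace PS

/-- the `c`-neighbourhood of `x` is the set of even positions -/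
def Ev (P : PS G m) (c : C) : Prop :=
  ∀ q, 1 ≤ q → q < 2 * m → ((G c).Adj P.x (P.v q) ↔ Even q)

theorem not1 (H : Hyp G m) (P : PS G m) : ¬ (G P.s).Adj P.x (P.v 1) := by
  intro h
  have hb := H.big
  have q := (Pth.single P.x).join _ h (P.blk (a := 1) (b := 2 * m - 1) le_rfl (by omega) (by omega))
  refine H.noham P.x (P.v (2 * m - 1)) ?_
  convert q using 1
  · rw [← P.hv, show 2 * m - 1 + 1 = 2 * m by omega]
  · rw [← P.hc, zero_add]

theorem notL (H : Hyp G m) (P : PS G m) : ¬ (G P.s).Adj P.x (P.v (2 * m - 1)) := by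
  have := P.rev.not1 H
  exact this

theorem evs_of_set {P : PS G m} {c : C}
    (h : (Finset.Ico 1 (2 * m)).filter (fun q => (G c).Adj P.x (P.v q)) = evs m) : P.Ev c := by
  intro q h1 h2
  have := congrArg (q ∈ ·) h
  simp only [Finset.mem_filter, Finset.mem_Ico, mem_evs, eq_iff_iff] at this
  constructor
  · intro h'; exact (this.1 ⟨⟨h1, h2⟩, h'⟩).2
  · intro h'; exact (this.2 ⟨⟨h1, h2⟩, h'⟩).2

theorem ev_of_not_acc (H : Hyp G m) (P : PS G m) {k : ℕ} (h : ¬ P.Acc k) :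
    P.Ev P.s ∧ P.Ev (P.c k) := by
  have hb := H.big
  obtain ⟨e1, e2⟩ := evens_of (m := m) (by omega)
    ((Finset.Ico 1 (2 * m)).filter (fun q => (G P.s).Adj P.x (P.v q)))
    ((Finset.Ico 1 (2 * m)).filter (fun q => (G (P.c k)).Adj P.x (P.v q)))
    (by
      intro s hs
      rw [Finset.mem_filter, Finset.mem_Ico] at hs
      have : s ≠ 1 := by rintro rfl; exact P.not1 H hs.2
      have : s ≠ 2 * m - 1 := by rintro rfl; exact P.notL H hs.2
      omega)
    (by
      intro s hs
      rw [Finset.mem_filter, Finset.mem_Ico] at hs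
      exact hs.1)
    (P.dgx H _) (P.dgx H _)
    (by
      intro l h1 h2
      rw [Finset.mem_filter, Finset.mem_Ico] at h1 h2
      exact h ⟨l, h1.1.1, h2.1.2, Or.inl ⟨h1.2, h2.2⟩⟩)
    (by
      intro l h1 h2
      rw [Finset.mem_filter, Finset.mem_Ico] at h1 h2
      exact h ⟨l, h1.1.1, h2.1.2, Or.inr ⟨h1.2, h2.2⟩⟩)
  exact ⟨evs_of_set e1, evs_of_set e2⟩

theorem odd_of_not_ev (H : Hyp G m) (P : PS G m) {c : C} (h : ¬ P.Ev c) :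
    ∃ q, 1 ≤ q ∧ q < 2 * m ∧ Odd q ∧ (G c).Adj P.x (P.v q) := by
  by_contra hno
  push Not at hno
  apply h
  apply evs_of_set
  apply Finset.eq_of_subset_of_card_le
  · intro q hq
    rw [Finset.mem_filter, Finset.mem_Ico] at hq
    rw [mem_evs]
    refine ⟨hq.1, ?_⟩
    by_contra hodd
    exact hno q hq.1.1 hq.1.2 (Nat.not_even_iff_odd.1 hodd) hq.2
  · rw [card_evs]
    have := P.dgx H c
    omega

end PS
end Evens


section Counting
open scoped Classical
variable {V C : Type} [Fintype V] [Fintype C] {G : C → SimpleGraph V} {m : ℕ}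

namespace PS

/-- the set `A'_u` -/
noncomputable def Apr (P : PS G m) (u : V) : Finset ℕ :=
  (Finset.Ico 1 (2 * m - 1)).filter fun p => (G (P.c p)).Adj (P.v (p + 1)) u

theorem mem_Apr {P : PS G m} {u : V} {p : ℕ} :
    p ∈ P.Apr u ↔ (1 ≤ p ∧ p + 1 < 2 * m) ∧ (G (P.c p)).Adj (P.v (p + 1)) u := by
  rw [Apr, Finset.mem_filter, Finset.mem_Ico, show p < 2 * m - 1 ↔ p + 1 < 2 * m by omega]

/-- inaccessible indices -/
noncomputable def inacc (P : PS G m) : Finset ℕ :=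
  (Finset.Ico 1 (2 * m - 1)).filter fun p => ¬ P.Acc p

theorem mem_inacc {P : PS G m} {p : ℕ} :
    p ∈ P.inacc ↔ (1 ≤ p ∧ p + 1 < 2 * m) ∧ ¬ P.Acc p := by
  rw [inacc, Finset.mem_filter, Finset.mem_Ico, show p < 2 * m - 1 ↔ p + 1 < 2 * m by omega]

/-- neighbour positions -/
noncomputable def Nb (P : PS G m) (c : C) (u : V) : Finset ℕ :=
  (Finset.Ico 1 (2 * m)).filter fun i => (G c).Adj u (P.v i)

theorem mem_Nb {P : PS G m} {c : C} {u : V} {i : ℕ} :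
    i ∈ P.Nb c u ↔ (1 ≤ i ∧ i < 2 * m) ∧ (G c).Adj u (P.v i) := by
  rw [Nb, Finset.mem_filter, Finset.mem_Ico]

theorem card_Nb (H : Hyp G m) (P : PS G m) (c : C) (u : V) : m ≤ (P.Nb c u).card + 2 :=
  P.dg2 H c u

/-- disjointness count -/
theorem avoid {m : ℕ} (A N E : Finset ℕ) (hA : A ⊆ Finset.Ico 1 (2 * m))
    (hN : N ⊆ Finset.Ico 1 (2 * m)) (h : ∀ p ∈ A, p ∉ E → p ∉ N) :
    A.card + N.card ≤ 2 * m - 1 + E.card := by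
  have hd : Disjoint (A \ E) N := by
    rw [Finset.disjoint_left]
    intro a ha
    rw [Finset.mem_sdiff] at ha
    exact h a ha.1 ha.2
  have h1 : ((A \ E) ∪ N).card ≤ (Finset.Ico 1 (2 * m)).card :=
    Finset.card_le_card (Finset.union_subset (Finset.sdiff_subset.trans hA) hN)
  rw [Finset.card_union_of_disjoint hd, Nat.card_Ico] at h1
  have h2 := Finset.le_card_sdiff E A
  omega

theorem Nb_sub (P : PS G m) (c : C) (u : V) : P.Nb c u ⊆ Finset.Ico 1 (2 * m) :=
  Finset.filter_subset _ _

theorem Apr_sub (P : PS G m) (u : V) : P.Apr u ⊆ Finset.Ico 1 (2 * m) :=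
  (Finset.filter_subset _ _).trans (Finset.Ico_subset_Ico_right (by omega))

theorem typ (H : Hyp G m) (P : PS G m) {k : ℕ} (hk : 1 ≤ k) (hk' : k + 1 < 2 * m)
    (h : P.Acc k) : (P.Apr (P.v (k + 1))).card ≤ m + 3 := by
  obtain ⟨l, hl⟩ := h
  obtain ⟨W, K, Q⟩ := hl.tp H hk hk'
  have h1 := avoid (m := m) (P.Apr (P.v (k + 1))) (P.Nb (P.c l) (P.v k)) {l, k} (P.Apr_sub _)
    (P.Nb_sub _ _) (by
      intro p hp hpE hpN
      rw [mem_Apr] at hp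
      rw [mem_Nb] at hpN
      simp only [Finset.mem_insert, Finset.mem_singleton, not_or] at hpE
      exact Q.r3 H hp.1.1 hp.1.2 hpE.1 hpE.2 hp.2 hpN.2)
  have h2 := P.card_Nb H (P.c l) (P.v k)
  have h3 : ({l, k} : Finset ℕ).card ≤ 2 := Finset.card_le_two
  omega

theorem sum_Apr (H : Hyp G m) (P : PS G m) :
    (2 * m - 2) * (m - 2) ≤ ∑ k ∈ Finset.Ico 1 (2 * m), (P.Apr (P.v k)).card := by
  have : ∑ k ∈ Finset.Ico 1 (2 * m), (P.Apr (P.v k)).card =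
      ∑ p ∈ Finset.Ico 1 (2 * m - 1), (P.Nb (P.c p) (P.v (p + 1))).card := by
    simp only [Apr, Nb, Finset.card_filter]
    exact Finset.sum_comm
  rw [this]
  have h2 : ∀ p ∈ Finset.Ico 1 (2 * m - 1), m - 2 ≤ (P.Nb (P.c p) (P.v (p + 1))).card := by
    intro p _
    have := P.card_Nb H (P.c p) (P.v (p + 1))
    omega
  have h3 := Finset.card_nsmul_le_sum _ _ _ h2
  rw [Nat.card_Ico, smul_eq_mul] at h3
  exact h3

theorem atyp (H : Hyp G m) (P : PS G m) {e : ℕ} (he : P.inacc.card ≤ e) (d : ℕ) :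
    d * ((Finset.Ico 1 (2 * m)).filter fun k => (P.Apr (P.v k)).card + d < m + 3).card
      ≤ 11 * m + (2 * m + d) * (e + 1) := by
  have hb := H.big
  set B := (Finset.Ico 1 (2 * m)).filter fun k => (P.Apr (P.v k)).card + d < m + 3 with hB
  set N := (Finset.Ico 1 (2 * m)).filter fun k => k = 1 ∨ ¬ P.Acc (k - 1) with hN
  have hNc : N.card ≤ e + 1 := by
    have : N ⊆ insert 1 (P.inacc.image (· + 1)) := by
      intro k hk
      rw [hN, Finset.mem_filter, Finset.mem_Ico] at hk
      rw [Finset.mem_insert, Finset.mem_image]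
      by_cases h1 : k = 1
      · exact Or.inl h1
      · right
        refine ⟨k - 1, ?_, by omega⟩
        rw [mem_inacc]
        exact ⟨by omega, by tauto⟩
    calc N.card ≤ _ := Finset.card_le_card this
      _ ≤ (P.inacc.image (· + 1)).card + 1 := Finset.card_insert_le _ _
      _ ≤ P.inacc.card + 1 := Nat.add_le_add_right Finset.card_image_le 1
      _ ≤ e + 1 := by omega
  have hpt : ∀ k ∈ Finset.Ico 1 (2 * m), (P.Apr (P.v k)).card + d * (if k ∈ B then 1 else 0) ≤
      (m + 3) + (2 * m + d) * (if k ∈ N then 1 else 0) := by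
    intro k hk
    by_cases hkN : k ∈ N
    · rw [if_pos hkN]
      have h1 := Finset.card_le_card (P.Apr_sub (P.v k))
      rw [Nat.card_Ico] at h1
      split_ifs <;> omega
    · rw [if_neg hkN]
      by_cases hkB : k ∈ B
      · rw [if_pos hkB]
        rw [hB, Finset.mem_filter] at hkB
        omega
      · rw [if_neg hkB]
        have hk2 := hk
        rw [Finset.mem_Ico] at hk2
        have : ¬ (k = 1 ∨ ¬ P.Acc (k - 1)) := by
          intro h; exact hkN (by rw [hN, Finset.mem_filter]; exact ⟨hk, h⟩)
        push Not at this
        have h1 := P.typ H (k := k - 1) (by omega) (by omega) this.2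
        rw [show k - 1 + 1 = k by omega] at h1
        omega
  have hs := Finset.sum_le_sum hpt
  rw [Finset.sum_add_distrib, Finset.sum_add_distrib, ← Finset.mul_sum, ← Finset.mul_sum,
    Finset.sum_const, Nat.card_Ico, smul_eq_mul, Finset.sum_ite_mem, Finset.sum_ite_mem,
    Finset.inter_eq_right.2 (Finset.filter_subset _ _),
    Finset.inter_eq_right.2 (Finset.filter_subset _ _)] at hs
  simp only [Finset.sum_const, smul_eq_mul, mul_one] at hs
  rw [← hB, ← hN] at hs
  have h0 := P.sum_Apr H
  have h4 : (2 * m + d) * N.card ≤ (2 * m + d) * (e + 1) := Nat.mul_le_mul_left _ hNc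
  have h5 : (2 * m - 1) * (m + 3) ≤ (2 * m - 2) * (m - 2) + 11 * m := by
    obtain ⟨r, rfl⟩ : ∃ r, m = r + 2 := ⟨m - 2, by omega⟩
    rw [show 2 * (r + 2) - 1 = 2 * r + 3 by omega, show 2 * (r + 2) - 2 = 2 * r + 2 by omega,
      show r + 2 - 2 = r by omega]
    nlinarith
  omega

/-- the set `U_k` -/
noncomputable def Us (P : PS G m) (k : ℕ) : Finset ℕ :=
  (Finset.Ico 1 (2 * m)).filter fun q =>
    (2 ≤ q ∧ q ≤ k ∧ (G (P.c (q - 1))).Adj (P.v (q - 1)) (P.v k)) ∨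
    (k < q ∧ q + 1 < 2 * m ∧ (G (P.c q)).Adj (P.v (q + 1)) (P.v k))

theorem Us_bound (H : Hyp G m) (P : PS G m) {k : ℕ} (hk : 1 ≤ k) (hk' : k + 1 < 2 * m)
    (h : P.Acc k) : (P.Us k \ P.Apr (P.v 1)).card + (P.Apr (P.v 1)).card ≤ m + 4 := by
  obtain ⟨l, hl⟩ := h
  obtain ⟨W, K, Q⟩ := hl.tp H hk hk'
  rw [Finset.card_sdiff_add_card]
  have h1 := avoid (m := m) (P.Us k ∪ P.Apr (P.v 1)) (P.Nb (P.c l) (P.v (2 * m - 1))) {l, k, l + 1}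
    (Finset.union_subset (Finset.filter_subset _ _) (P.Apr_sub _))
    (P.Nb_sub _ _) (by
      intro q hq hqE hqN
      rw [mem_Nb] at hqN
      simp only [Finset.mem_insert, Finset.mem_singleton, not_or] at hqE
      rw [Finset.mem_union, mem_Apr, Us, Finset.mem_filter] at hq
      rcases hq with ⟨hq, ⟨h2, h3, h4⟩ | ⟨h2, h3, h4⟩⟩ | ⟨hq, h4⟩
      · refine Q.r1 H (p := q - 1) (by omega) (by omega) (by omega) h4 ?_
        rw [Nat.sub_add_cancel (by omega)]
        exact hqN.2
      · exact Q.r1' H h2 h3 hqE.1 h4 hqN.2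
      · exact Q.r2 H hq.1 hq.2 hqE.1 hqE.2.1 h4 hqN.2)
  have h2 := P.card_Nb H (P.c l) (P.v (2 * m - 1))
  have h3 : ({l, k, l + 1} : Finset ℕ).card ≤ 3 := Finset.card_le_three
  omega

theorem Us_lower (H : Hyp G m) (P : PS G m) {t q : ℕ} (hq : 2 ≤ q) (hq' : q + 1 < 2 * m)
    (h : q + t ≤ m ∨ m + 1 + t ≤ q) :
    t ≤ ((Finset.Ico 1 (2 * m)).filter fun k => q ∈ P.Us k).card := by
  rcases h with h | h
  · have h1 := P.card_Nb H (P.c (q - 1)) (P.v (q - 1))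
    have h2 : P.Nb (P.c (q - 1)) (P.v (q - 1)) ⊆
        ((Finset.Ico 1 (2 * m)).filter fun k => q ∈ P.Us k) ∪ Finset.Ico 1 (q - 1) := by
      intro k hk
      rw [mem_Nb] at hk
      rw [Finset.mem_union, Finset.mem_Ico, Finset.mem_filter, Finset.mem_Ico, Us,
        Finset.mem_filter, Finset.mem_Ico]
      have hne : k ≠ q - 1 := by rintro rfl; exact (G _).irrefl hk.2
      by_cases hqk : q ≤ k
      · left
        exact ⟨hk.1, by omega, Or.inl ⟨hq, hqk, hk.2⟩⟩
      · right; omega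
    have h3 := (Finset.card_le_card h2).trans (Finset.card_union_le _ _)
    rw [Nat.card_Ico] at h3
    omega
  · have h1 := P.card_Nb H (P.c q) (P.v (q + 1))
    have h2 : P.Nb (P.c q) (P.v (q + 1)) ⊆
        ((Finset.Ico 1 (2 * m)).filter fun k => q ∈ P.Us k) ∪
          (Finset.Ico q (2 * m)).erase (q + 1) := by
      intro k hk
      rw [mem_Nb] at hk
      rw [Finset.mem_union, Finset.mem_erase, Finset.mem_Ico, Finset.mem_filter, Finset.mem_Ico, Us,
        Finset.mem_filter, Finset.mem_Ico]
      have hne : k ≠ q + 1 := by rintro rfl; exact (G _).irrefl hk.2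
      by_cases hqk : q ≤ k
      · right; omega
      · left
        exact ⟨hk.1, by omega, Or.inr ⟨by omega, hq', hk.2⟩⟩
    have h3 := (Finset.card_le_card h2).trans (Finset.card_union_le _ _)
    rw [Finset.card_erase_of_mem (by rw [Finset.mem_Ico]; omega), Nat.card_Ico] at h3
    omega

theorem contra1 (H : Hyp G m) (P : PS G m) {e b t : ℕ} (he : P.inacc.card ≤ e) (hem : e < m)
    (hb : m + 4 ≤ (P.Apr (P.v 1)).card + b) (ht : 2 * t + 7 ≤ m) :
    (m - 7 - 2 * t) * t ≤ 2 * m * b + 2 * m * (e + 1) := by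
  have hbig := H.big
  set A := P.Apr (P.v 1) with hA
  -- an accessible index
  have hAc : A.card ≤ m + 4 := by
    have : ∃ k ∈ Finset.Ico 1 (2 * m - 1), k ∉ P.inacc := by
      by_contra hno
      push Not at hno
      have := Finset.card_le_card (fun k hk => hno k hk : Finset.Ico 1 (2 * m - 1) ⊆ P.inacc)
      rw [Nat.card_Ico] at this
      omega
    obtain ⟨k, hk, hk'⟩ := this
    rw [Finset.mem_Ico] at hk
    rw [mem_inacc] at hk'
    have hacc : P.Acc k := by
      by_contra h; exact hk' ⟨by omega, h⟩
    have := P.Us_bound H hk.1 (by omega) hacc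
    rw [← hA] at this
    omega
  set N := (Finset.Ico 1 (2 * m)).filter fun k => k = 2 * m - 1 ∨ ¬ P.Acc k with hN
  have hNc : N.card ≤ e + 1 := by
    have : N ⊆ insert (2 * m - 1) P.inacc := by
      intro k hk
      rw [hN, Finset.mem_filter, Finset.mem_Ico] at hk
      rw [Finset.mem_insert, mem_inacc]
      by_cases h1 : k = 2 * m - 1
      · exact Or.inl h1
      · right
        exact ⟨by omega, by tauto⟩
    calc N.card ≤ _ := Finset.card_le_card this
      _ ≤ P.inacc.card + 1 := Finset.card_insert_le _ _
      _ ≤ e + 1 := by omega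
  have hpt : ∀ k ∈ Finset.Ico 1 (2 * m), (P.Us k \ A).card ≤
      b + (2 * m) * (if k ∈ N then 1 else 0) := by
    intro k hk
    by_cases hkN : k ∈ N
    · rw [if_pos hkN]
      have h1 := Finset.card_le_card (Finset.sdiff_subset.trans
        (Finset.filter_subset _ _) : P.Us k \ A ⊆ Finset.Ico 1 (2 * m))
      rw [Nat.card_Ico] at h1
      omega
    · rw [if_neg hkN]
      have hk2 := hk
      rw [Finset.mem_Ico] at hk2
      have : ¬ (k = 2 * m - 1 ∨ ¬ P.Acc k) := by
        intro h; exact hkN (by rw [hN, Finset.mem_filter]; exact ⟨hk, h⟩)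
      push Not at this
      have h1 := P.Us_bound H (k := k) (by omega) (by omega) this.2
      rw [← hA] at h1
      omega
  have hs := Finset.sum_le_sum hpt
  rw [Finset.sum_add_distrib, ← Finset.mul_sum,
    Finset.sum_const, Nat.card_Ico, smul_eq_mul, Finset.sum_ite_mem,
    Finset.inter_eq_right.2 (Finset.filter_subset _ _)] at hs
  simp only [Finset.sum_const, smul_eq_mul, mul_one] at hs
  -- lower bound
  have hdc : ∑ k ∈ Finset.Ico 1 (2 * m), (P.Us k \ A).card =
      ∑ q ∈ Finset.Ico 1 (2 * m) \ A,
        ((Finset.Ico 1 (2 * m)).filter fun k => q ∈ P.Us k).card := by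
    have h1 : ∀ k, P.Us k \ A = (Finset.Ico 1 (2 * m) \ A).filter (fun q => q ∈ P.Us k) := by
      intro k
      ext q
      rw [Finset.mem_sdiff, Finset.mem_filter, Finset.mem_sdiff]
      constructor
      · rintro ⟨h1, h2⟩
        exact ⟨⟨Finset.filter_subset _ _ h1, h2⟩, h1⟩
      · rintro ⟨⟨_, h2⟩, h3⟩
        exact ⟨h3, h2⟩
    simp only [h1, Finset.card_filter]
    exact Finset.sum_comm
  set Gd := (Finset.Ico 1 (2 * m) \ A).filter fun q =>
    (2 ≤ q ∧ q + 1 < 2 * m) ∧ (q + t ≤ m ∨ m + 1 + t ≤ q) with hGd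
  have hlow : Gd.card * t ≤ ∑ k ∈ Finset.Ico 1 (2 * m), (P.Us k \ A).card := by
    rw [hdc]
    refine le_trans ?_ (Finset.sum_le_sum_of_subset (Finset.filter_subset _ _ : Gd ⊆ _))
    rw [← smul_eq_mul]
    apply Finset.card_nsmul_le_sum
    intro q hq
    rw [hGd, Finset.mem_filter] at hq
    exact P.Us_lower H hq.2.1.1 hq.2.1.2 hq.2.2
  have hGc : m - 7 - 2 * t ≤ Gd.card := by
    have h1 : Finset.Ico 1 (2 * m) ⊆ Gd ∪ (A ∪ ({1, 2 * m - 1} ∪ Finset.Ico (m + 1 - t) (m + 1 + t))) := by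
      intro q hq
      simp only [hGd, Finset.mem_union, Finset.mem_filter, Finset.mem_sdiff, Finset.mem_insert,
        Finset.mem_singleton, Finset.mem_Ico]
      rw [Finset.mem_Ico] at hq
      by_cases hqA : q ∈ A
      · tauto
      · by_cases h2 : (2 ≤ q ∧ q + 1 < 2 * m) ∧ (q + t ≤ m ∨ m + 1 + t ≤ q)
        · left; exact ⟨⟨hq, hqA⟩, h2⟩
        · right; right; omega
    have h2 := Finset.card_le_card h1
    have h3 := Finset.card_union_le Gd (A ∪ ({1, 2 * m - 1} ∪ Finset.Ico (m + 1 - t) (m + 1 + t)))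
    have h4 := Finset.card_union_le A ({1, 2 * m - 1} ∪ Finset.Ico (m + 1 - t) (m + 1 + t))
    have h5 := Finset.card_union_le ({1, 2 * m - 1} : Finset ℕ) (Finset.Ico (m + 1 - t) (m + 1 + t))
    have h6 : ({1, 2 * m - 1} : Finset ℕ).card ≤ 2 := Finset.card_le_two
    rw [Nat.card_Ico] at h2 h5
    omega
  calc (m - 7 - 2 * t) * t ≤ Gd.card * t := Nat.mul_le_mul_right _ hGc
    _ ≤ _ := hlow
    _ ≤ _ := hs
    _ ≤ _ := by
      apply Nat.add_le_add
      · exact Nat.mul_le_mul_right _ (by omega)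
      · exact Nat.mul_le_mul_left _ hNc

theorem contra (H : Hyp G m) (P : PS G m) {e b : ℕ} (he : P.inacc.card ≤ e)
    (hem : 2000000 * e ≤ m) (hb : m + 4 ≤ (P.Apr (P.v 1)).card + b) (hb' : 32 * b ≤ m + 1000) :
    False := by
  have hbig := H.big
  obtain ⟨t, ht⟩ : ∃ t, t = m / 4 := ⟨_, rfl⟩
  have h1 := P.contra1 H (t := t) he (by omega) hb (by omega)
  obtain ⟨r, hr⟩ : ∃ r, r = m - 7 - 2 * t := ⟨_, rfl⟩
  rw [← hr] at h1
  have hr2 : m ≤ 2 * r + 14 := by omega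
  have ht2 : m ≤ 4 * t + 3 := by omega
  have h2 : (m - 14) * (m - 3) ≤ (2 * r) * (4 * t) := Nat.mul_le_mul (by omega) (by omega)
  have h3 : (2 * m) * (32 * b + 32 * e + 32) ≤ (2 * m) * (m + 1000 + m / 8 + 32) :=
    Nat.mul_le_mul_left _ (by omega)
  obtain ⟨z, rfl⟩ : ∃ z, m = z + 14 := ⟨m - 14, by omega⟩
  have h4 : (z + 14) / 8 * 8 ≤ z + 14 := Nat.div_mul_le_self _ _
  rw [show z + 14 - 14 = z by omega, show z + 14 - 3 = z + 11 by omega] at h2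
  have h5 : 10000 * z ≤ z * z := Nat.mul_le_mul_right _ (by omega)
  nlinarith

end PS
end Counting


section MainLemma
open scoped Classical
variable {V C : Type} [Fintype V] [Fintype C] {G : C → SimpleGraph V} {m : ℕ}

namespace PS

/-- rotation at `p` is allowed -/
def RotOK (P : PS G m) (p : ℕ) : Prop :=
  1 ≤ p ∧ p + 1 < 2 * m ∧ (G P.s).Adj (P.v 1) (P.v (p + 1))

/-- bundled rotation -/
noncomputable def ro (P : PS G m) {p : ℕ} (h : P.RotOK p) : PS G m := P.rot p h.1 h.2.1 h.2.2

theorem ro_v (P : PS G m) {p : ℕ} (h : P.RotOK p) (i : ℕ) :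
    (P.ro h).v i = if i ≤ p then P.v (p + 1 - i) else P.v i := rfl

theorem ro_c (P : PS G m) {p : ℕ} (h : P.RotOK p) (i : ℕ) :
    (P.ro h).c i = if i < p then P.c (p - i) else if i = p then P.s else P.c i := rfl

theorem ro_x (P : PS G m) {p : ℕ} (h : P.RotOK p) : (P.ro h).x = P.x := rfl

theorem ro_s (P : PS G m) {p : ℕ} (h : P.RotOK p) : (P.ro h).s = P.c p := rfl

/-- auxiliary index set -/
noncomputable def Fs (P : PS G m) (p : ℕ) (u : V) : Finset ℕ :=
  (Finset.Ico 1 (2 * m - 1)).filter fun q =>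
    (q < p ∧ (G (P.c q)).Adj (P.v q) u) ∨ (p < q ∧ (G (P.c q)).Adj (P.v (q + 1)) u)

theorem mem_Fs {P : PS G m} {p q : ℕ} {u : V} : q ∈ P.Fs p u ↔ (1 ≤ q ∧ q + 1 < 2 * m) ∧
    ((q < p ∧ (G (P.c q)).Adj (P.v q) u) ∨ (p < q ∧ (G (P.c q)).Adj (P.v (q + 1)) u)) := by
  rw [Fs, Finset.mem_filter, Finset.mem_Ico, show q < 2 * m - 1 ↔ q + 1 < 2 * m by omega]

theorem fA (P : PS G m) {p : ℕ} (h : P.RotOK p) (u : V) :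
    ((P.ro h).Apr u).card ≤ (P.Fs p u).card + 1 := by
  have h1 : (((P.ro h).Apr u).erase p).card ≤ (P.Fs p u).card := by
    apply Finset.card_le_card_of_injOn (fun i => if i < p then p - i else i)
    · intro i hi
      rw [Finset.mem_coe, Finset.mem_erase, mem_Apr, ro_v, ro_c] at hi
      obtain ⟨hip, hi1, hi2⟩ := hi
      rw [Finset.mem_coe, mem_Fs]
      beta_reduce
      by_cases hlt : i < p
      · rw [if_pos hlt]
        rw [if_pos hlt, if_pos (show i + 1 ≤ p by omega), show p + 1 - (i + 1) = p - i by omega] at hi2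
        exact ⟨by have := h.2.1; omega, Or.inl ⟨by omega, hi2⟩⟩
      · rw [if_neg hlt]
        rw [if_neg hlt, if_neg (show ¬ i + 1 ≤ p by omega), if_neg hip] at hi2
        exact ⟨hi1, Or.inr ⟨by omega, hi2⟩⟩
    · intro i hi j hj hij
      rw [Finset.mem_coe, Finset.mem_erase, mem_Apr] at hi hj
      simp only at hij
      split_ifs at hij <;> omega
  have := Finset.pred_card_le_card_erase (s := (P.ro h).Apr u) (a := p)
  omega

theorem fB (P : PS G m) {p : ℕ} (h : P.RotOK p) (u : V) :
    (P.Fs p u).card ≤ ((P.ro h).Apr u).card := by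
  apply Finset.card_le_card_of_injOn (fun i => if i < p then p - i else i)
  · intro i hi
    rw [Finset.mem_coe, mem_Fs] at hi
    obtain ⟨hi1, hi2⟩ := hi
    rw [Finset.mem_coe, mem_Apr, ro_v, ro_c]
    beta_reduce
    by_cases hlt : i < p
    · rw [if_pos hlt, if_pos (show p - i < p by omega), if_pos (show p - i + 1 ≤ p by omega)]
      rw [show p - (p - i) = i by omega, show p + 1 - (p - i + 1) = i by omega]
      refine ⟨by have := h.2.1; omega, ?_⟩
      rcases hi2 with hi2 | hi2
      · exact hi2.2
      · omega
    · rw [if_neg hlt, if_neg hlt, if_neg (show ¬ i + 1 ≤ p by omega)]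
      rcases hi2 with hi2 | hi2
      · omega
      · rw [if_neg (by omega)]
        exact ⟨hi1, hi2.2⟩
  · intro i hi j hj hij
    rw [Finset.mem_coe, mem_Fs] at hi hj
    simp only at hij
    split_ifs at hij <;> omega

theorem fC (P : PS G m) {p k w : ℕ} (h1 : p ≤ k + w) (h2 : k ≤ p + w) (u : V) :
    (P.Fs p u).card ≤ (P.Fs k u).card + w + 1 := by
  have h : P.Fs p u ⊆ P.Fs k u ∪ Finset.Ico (min p k) (max p k + 1) := by
    intro q hq
    rw [mem_Fs] at hq
    rw [Finset.mem_union, mem_Fs, Finset.mem_Ico]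
    by_cases hr : min p k ≤ q ∧ q < max p k + 1
    · exact Or.inr hr
    · left
      refine ⟨hq.1, ?_⟩
      rcases hq.2 with ⟨h3, h4⟩ | ⟨h3, h4⟩
      · exact Or.inl ⟨by omega, h4⟩
      · exact Or.inr ⟨by omega, h4⟩
  have := (Finset.card_le_card h).trans (Finset.card_union_le _ _)
  rw [Nat.card_Ico] at this
  omega

/-- rotations with few inaccessible indices -/
noncomputable def Tacc (P : PS G m) (e : ℕ) : Finset ℕ :=
  (Finset.Ico 1 (2 * m - 1)).filter fun p => ∃ h : P.RotOK p, (P.ro h).inacc.card ≤ e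

theorem main_lemma (H : Hyp G m) (P : PS G m) {e : ℕ} (he : 2000000 * e ≤ m) :
    64 * (P.Tacc e).card ≤ m := by
  have hbig := H.big
  by_contra hlt
  push Not at hlt
  obtain ⟨w, hw⟩ : ∃ w, w = m / 64 := ⟨_, rfl⟩
  obtain ⟨β, hβ⟩ : ∃ β, β = m / 10000 := ⟨_, rfl⟩
  have hmap : ∀ p ∈ P.Tacc e, p / w ∈ Finset.range 129 := by
    intro p hp
    rw [Tacc, Finset.mem_filter, Finset.mem_Ico] at hp
    rw [Finset.mem_range, Nat.div_lt_iff_lt_mul (by omega)]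
    omega
  obtain ⟨y, _, hy⟩ := Finset.exists_lt_card_fiber_of_mul_lt_card_of_maps_to hmap
    (n := β) (by rw [Finset.card_range]; omega)
  set Fb := (P.Tacc e).filter (fun p => p / w = y) with hFb
  have hFm : ∀ p ∈ Fb, (∃ h : P.RotOK p, (P.ro h).inacc.card ≤ e) ∧ p / w = y := by
    intro p hp
    rw [hFb, Finset.mem_filter, Tacc, Finset.mem_filter] at hp
    exact ⟨hp.1.2, hp.2⟩
  obtain ⟨p, hp⟩ : Fb.Nonempty := by rw [← Finset.card_pos]; omega
  obtain ⟨⟨hpr, hpe⟩, hpy⟩ := hFm p hp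
  have hat := (P.ro hpr).atyp H hpe w
  set B := (Finset.Ico 1 (2 * m)).filter fun k =>
    ((P.ro hpr).Apr ((P.ro hpr).v k)).card + w < m + 3 with hB
  have hex : ∃ k ∈ Fb, m + 3 ≤ ((P.ro hpr).Apr (P.v k)).card + w := by
    by_contra hno
    push Not at hno
    have hle : Fb.card ≤ B.card := by
      apply Finset.card_le_card_of_injOn (fun k => if k ≤ p then p + 1 - k else k)
      · intro k hk
        obtain ⟨⟨hkr, _⟩, _⟩ := hFm k hk
        have hn := hno k hk
        have hk1 := hkr.1
        have hk2 := hkr.2.1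
        have hp2 := hpr.2.1
        rw [Finset.mem_coe, hB, Finset.mem_filter, Finset.mem_Ico]
        beta_reduce
        by_cases hkp : k ≤ p
        · rw [if_pos hkp]
          refine ⟨by omega, ?_⟩
          rw [ro_v, if_pos (by omega), show p + 1 - (p + 1 - k) = k by omega]
          exact hn
        · rw [if_neg hkp]
          refine ⟨by omega, ?_⟩
          rw [ro_v, if_neg (by omega)]
          exact hn
      · intro i hi j hj hij
        obtain ⟨⟨hir, _⟩, _⟩ := hFm i hi
        obtain ⟨⟨hjr, _⟩, _⟩ := hFm j hj
        have := hir.1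
        have := hjr.1
        simp only at hij
        split_ifs at hij <;> omega
    have h1 : w * (β + 1) ≤ w * B.card := Nat.mul_le_mul_left _ (by omega)
    have h2 : (m - 63) * m ≤ (64 * w) * (10000 * (β + 1)) := Nat.mul_le_mul (by omega) (by omega)
    have h3 : (64 * (2 * m + w)) * (2000000 * (e + 1)) ≤ (129 * m) * (m + 2000000) :=
      Nat.mul_le_mul (by omega) (by omega)
    have h4 : 1000000000000 * m ≤ m * m := Nat.mul_le_mul_right _ hbig
    obtain ⟨z, rfl⟩ : ∃ z, m = z + 63 := ⟨m - 63, by omega⟩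
    rw [Nat.add_sub_cancel] at h2
    nlinarith
  obtain ⟨k, hk, hkt⟩ := hex
  obtain ⟨⟨hkr, hke⟩, hky⟩ := hFm k hk
  have hwpos : 0 < w := by omega
  have d1 : p / w * w ≤ p := Nat.div_mul_le_self _ _
  have d2 : k / w * w ≤ k := Nat.div_mul_le_self _ _
  have d3 : p < p / w * w + w := Nat.lt_div_mul_add hwpos
  have d4 : k < k / w * w + w := Nat.lt_div_mul_add hwpos
  rw [hpy] at d1 d3
  rw [hky] at d2 d4
  have f1 := P.fA hpr (P.v k)
  have f2 := P.fB hkr (P.v k)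
  have f3 := P.fC (p := p) (k := k) (w := w) (by omega) (by omega) (P.v k)
  have hv1 : (P.ro hkr).v 1 = P.v k := by
    rw [ro_v, if_pos hkr.1, Nat.add_sub_cancel]
  refine (P.ro hkr).contra H (e := e) (b := 2 * w + 5) hke he ?_ (by omega)
  rw [hv1]
  omega

theorem ev_ro_odd (P : PS G m) {p : ℕ} (h : P.RotOK p) (hp : Odd p) (c : C) :
    (P.ro h).Ev c ↔ P.Ev c := by
  have h2 := h.2.1
  rw [Nat.odd_iff] at hp
  constructor
  · intro hE q hq hq'
    by_cases hqp : q ≤ p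
    · have := hE (p + 1 - q) (by omega) (by omega)
      rw [ro_x, ro_v, if_pos (by omega), show p + 1 - (p + 1 - q) = q by omega] at this
      rw [this, Nat.even_iff, Nat.even_iff]
      omega
    · have := hE q hq hq'
      rwa [ro_x, ro_v, if_neg hqp] at this
  · intro hE q hq hq'
    rw [ro_x, ro_v]
    by_cases hqp : q ≤ p
    · rw [if_pos hqp, hE (p + 1 - q) (by omega) (by omega), Nat.even_iff, Nat.even_iff]
      omega
    · rw [if_neg hqp]
      exact hE q hq hq'

theorem ev_ro_even (P : PS G m) {p p' : ℕ} (h : P.RotOK p) (h' : P.RotOK p') (hp : Even p)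
    (hp' : Even p') (hlt : p < p') {c : C} (e1 : (P.ro h).Ev c) (e2 : (P.ro h').Ev c) : False := by
  rw [Nat.even_iff] at hp hp'
  have h2 := h'.2.1
  have a1 := e1 (p + 2) (by omega) (by omega)
  rw [ro_x, ro_v, if_neg (by omega), Nat.even_iff] at a1
  have a2 := e2 (p' + 1 - (p + 2)) (by omega) (by omega)
  rw [ro_x, ro_v, if_pos (by omega), show p' + 1 - (p' + 1 - (p + 2)) = p + 2 by omega,
    Nat.even_iff] at a2
  have := a2.1 (a1.2 (by omega))
  omega

theorem ev_rev (P : PS G m) (c : C) : P.rev.Ev c ↔ P.Ev c := by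
  constructor
  · intro hE q hq hq'
    have := hE (2 * m - q) (by omega) (by omega)
    have e : P.rev.v (2 * m - q) = P.v q := by
      change P.v (2 * m - (2 * m - q)) = P.v q
      congr 1; omega
    rw [e] at this
    change (G c).Adj P.x _ ↔ _ at this
    rw [this, Nat.even_iff, Nat.even_iff]
    omega
  · intro hE q hq hq'
    have := hE (2 * m - q) (by omega) (by omega)
    change (G c).Adj P.x (P.v (2 * m - q)) ↔ _
    rw [this, Nat.even_iff, Nat.even_iff]
    omega

/-- good odd indices -/
noncomputable def Od (P : PS G m) : Finset ℕ :=
  (Finset.Ico 1 (2 * m - 1)).filter fun p => Odd p ∧ P.RotOK p ∧ P.Ev (P.c p)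

theorem mem_Od {P : PS G m} {p : ℕ} : p ∈ P.Od ↔ (1 ≤ p ∧ p + 1 < 2 * m) ∧
    Odd p ∧ P.RotOK p ∧ P.Ev (P.c p) := by
  rw [Od, Finset.mem_filter, Finset.mem_Ico, show p < 2 * m - 1 ↔ p + 1 < 2 * m by omega]

theorem G1 (H : Hyp G m) (P : PS G m) : m ≤ P.Od.card + m / 64 + 4000001 := by
  have hbig := H.big
  obtain ⟨e, he⟩ : ∃ e, e = m / 2000000 := ⟨_, rfl⟩
  have hmain := P.main_lemma H (e := e) (by omega)
  set T := (Finset.Ico 1 (2 * m - 1)).filter fun p => P.RotOK p with hT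
  have hTc : m ≤ T.card + 1 := by
    have h1 := P.dgpos H P.s (P.v 1)
    rw [if_neg (fun h => P.not1 H h.symm), zero_add] at h1
    have h2 : ((Finset.Ico 1 (2 * m)).filter fun i => (G P.s).Adj (P.v 1) (P.v i)) ⊆
        T.image (· + 1) := by
      intro q hq
      rw [Finset.mem_filter, Finset.mem_Ico] at hq
      have hne : q ≠ 1 := by rintro rfl; exact (G _).irrefl hq.2
      rw [Finset.mem_image]
      refine ⟨q - 1, ?_, by omega⟩
      rw [hT, Finset.mem_filter, Finset.mem_Ico]
      refine ⟨by omega, by omega, by omega, ?_⟩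
      rw [Nat.sub_add_cancel (by omega)]
      exact hq.2
    have h3 := (Finset.card_le_card h2).trans Finset.card_image_le
    omega
  set E := T.filter fun p => p ∉ P.Tacc e ∧ Even p with hE
  have hno : ∀ p ∈ T, p ∉ P.Tacc e → ∃ h : P.RotOK p, e < (P.ro h).inacc.card := by
    intro p hp hpn
    rw [hT, Finset.mem_filter] at hp
    refine ⟨hp.2, ?_⟩
    by_contra hc
    apply hpn
    rw [Tacc, Finset.mem_filter]
    exact ⟨hp.1, hp.2, by omega⟩
  have hEc : E.card ≤ 4000000 := by
    let Cs : ℕ → Finset C := fun p => Finset.univ.filter fun c => ∃ h : P.RotOK p, (P.ro h).Ev c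
    have h1 : ∀ p ∈ E, e + 1 ≤ (Cs p).card := by
      intro p hp
      rw [hE, Finset.mem_filter] at hp
      obtain ⟨h, hc⟩ := hno p hp.1 hp.2.1
      refine le_trans hc ?_
      rw [← Finset.card_image_of_injOn (s := (P.ro h).inacc) (f := (P.ro h).c)]
      · apply Finset.card_le_card
        intro c hc
        rw [Finset.mem_image] at hc
        obtain ⟨k, hk, rfl⟩ := hc
        rw [mem_inacc] at hk
        simp only [Cs, Finset.mem_filter, Finset.mem_univ, true_and]
        exact ⟨h, ((P.ro h).ev_of_not_acc H hk.2).2⟩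
      · intro i hi j hj hij
        rw [Finset.mem_coe, mem_inacc] at hi hj
        exact (P.ro h).cinj hi.1.1 hi.1.2 hj.1.1 hj.1.2 hij
    have h2 : (E.biUnion Cs).card = ∑ p ∈ E, (Cs p).card := by
      apply Finset.card_biUnion
      intro p hp p' hp' hne
      rw [Finset.mem_coe, hE, Finset.mem_filter] at hp hp'
      rw [Function.onFun, Finset.disjoint_left]
      intro c hc hc'
      simp only [Cs, Finset.mem_filter, Finset.mem_univ, true_and] at hc hc'
      obtain ⟨h, hc⟩ := hc
      obtain ⟨h', hc'⟩ := hc'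
      rcases lt_or_gt_of_ne hne with hlt | hlt
      · exact P.ev_ro_even h h' hp.2.2 hp'.2.2 hlt hc hc'
      · exact P.ev_ro_even h' h hp'.2.2 hp.2.2 hlt hc' hc
    have h3 := Finset.card_nsmul_le_sum _ _ _ h1
    have h4 := Finset.card_le_univ (E.biUnion Cs)
    have h5 := H.cardC
    rw [smul_eq_mul, ← h2] at h3
    by_contra hgt
    have h6 : 4000001 * (e + 1) ≤ E.card * (e + 1) := Nat.mul_le_mul_right _ (by omega)
    omega
  have hcov : T ⊆ P.Od ∪ (P.Tacc e ∪ E) := by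
    intro p hp
    rw [Finset.mem_union, Finset.mem_union]
    by_cases ha : p ∈ P.Tacc e
    · tauto
    · by_cases hev : Even p
      · right; right; rw [hE, Finset.mem_filter]; exact ⟨hp, ha, hev⟩
      · left
        obtain ⟨h, hc⟩ := hno p hp ha
        rw [Nat.not_even_iff_odd] at hev
        obtain ⟨k, hk⟩ : (P.ro h).inacc.Nonempty := by rw [← Finset.card_pos]; omega
        rw [mem_inacc] at hk
        have h1 := ((P.ro h).ev_of_not_acc H hk.2).1
        rw [ev_ro_odd P h hev, ro_s] at h1
        rw [mem_Od]
        exact ⟨⟨h.1, h.2.1⟩, hev, h, h1⟩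
  have h1 := (Finset.card_le_card hcov).trans (Finset.card_union_le _ _)
  have h2 := Finset.card_union_le (P.Tacc e) E
  omega

theorem G2 (H : Hyp G m) (P : PS G m) :
    16 * (Finset.univ.filter fun c => ¬ P.Ev c).card ≤ m := by
  have hbig := H.big
  have g1 := P.G1 H
  have g2 := P.rev.G1 H
  set I := P.Od ∪ P.rev.Od.image (fun p => 2 * m - 1 - p) with hI
  have hIm : ∀ p ∈ I, (1 ≤ p ∧ p + 1 < 2 * m) ∧ P.Ev (P.c p) := by
    intro p hp
    rw [hI, Finset.mem_union, Finset.mem_image] at hp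
    rcases hp with hp | ⟨q, hq, rfl⟩
    · rw [mem_Od] at hp; exact ⟨hp.1, hp.2.2.2⟩
    · rw [mem_Od] at hq
      exact ⟨by omega, (P.ev_rev _).1 hq.2.2.2⟩
  have hIc : I.card = P.Od.card + P.rev.Od.card := by
    rw [hI, Finset.card_union_of_disjoint, Finset.card_image_of_injOn]
    · intro i hi j hj hij
      rw [Finset.mem_coe, mem_Od] at hi hj
      simp only at hij
      omega
    · rw [Finset.disjoint_left]
      intro a ha hb
      rw [Finset.mem_image] at hb
      obtain ⟨b, hb, rfl⟩ := hb
      rw [mem_Od] at ha hb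
      have e1 := ha.2.1
      have e2 := hb.2.1
      rw [Nat.odd_iff] at e1 e2
      omega
  have h1 : I.card ≤ (Finset.univ.filter fun c => P.Ev c).card := by
    apply Finset.card_le_card_of_injOn P.c
    · intro p hp
      simp only [Finset.coe_filter, Finset.mem_univ, true_and, Set.mem_ofPred_eq]
      exact (hIm p hp).2
    · intro i hi j hj hij
      have a := (hIm i hi).1
      have b := (hIm j hj).1
      exact P.cinj a.1 a.2 b.1 b.2 hij
  have h2 := Finset.card_filter_add_card_filter_not (s := (Finset.univ : Finset C)) (fun c => P.Ev c)
  rw [Finset.card_univ] at h2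
  have h3 := H.cardC
  omega

end PS
end MainLemma


section StepOne
open scoped Classical
variable {V C : Type} [Fintype V] [Fintype C] {G : C → SimpleGraph V} {m : ℕ}

namespace PS

theorem swapA_ev (P : PS G m) {i : ℕ} (h1 : 2 ≤ i) (h2 : i < 2 * m)
    (ha : (G P.s).Adj P.x (P.v (i - 1)))
    (hb : i + 1 < 2 * m → (G (P.c i)).Adj P.x (P.v (i + 1))) {c : C}
    (hE : (P.swapA i h1 h2 ha hb).Ev c) {j : ℕ} (hj : 1 ≤ j) (hj' : j < 2 * m) (hji : j ≠ i) :
    (G c).Adj (P.v i) (P.v j) ↔ Even j := by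
  have := hE j hj hj'
  change (G c).Adj (P.v i) (if j = i then P.x else P.v j) ↔ _ at this
  rwa [if_neg hji] at this

theorem core (H : Hyp G m) (P : PS G m) (hs : P.Ev P.s) {k q : ℕ} (hk : 1 ≤ k)
    (hk' : k + 1 < 2 * m) (hke : Even k) (hq : 1 ≤ q) (hq' : q < 2 * m) (hqo : Odd q)
    (hx : (G (P.c k)).Adj P.x (P.v q)) : False := by
  have hbig := H.big
  rw [Nat.even_iff] at hke
  rw [Nat.odd_iff] at hqo
  have hlink : ∃ l, P.Link k l := by
    by_cases h1 : q = 1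
    · subst h1
      refine ⟨1, le_rfl, by omega, Or.inr ⟨hx, ?_⟩⟩
      exact (hs 2 (by omega) (by omega)).2 (by decide)
    · refine ⟨q - 1, by omega, by omega, Or.inl ⟨?_, ?_⟩⟩
      · exact (hs (q - 1) (by omega) (by omega)).2 (Nat.even_iff.2 (by omega))
      · rw [Nat.sub_add_cancel (by omega)]; exact hx
  obtain ⟨l, hl⟩ := hlink
  obtain ⟨W, K, Q⟩ := hl.tp H hk hk'
  have haL : (G P.s).Adj P.x (P.v (2 * m - 1 - 1)) :=
    (hs _ (by omega) (by omega)).2 (Nat.even_iff.2 (by omega))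
  have hbL : 2 * m - 1 + 1 < 2 * m → (G (P.c (2 * m - 1))).Adj P.x (P.v (2 * m - 1 + 1)) := by
    intro h; omega
  set PL := P.swapA (2 * m - 1) (by omega) (by omega) haL hbL with hPL
  have bL := PL.G2 H
  have b0 := P.G2 H
  set D := (Finset.Ico 1 (2 * m - 1)).filter fun p => (G (P.c l)).Adj (P.v 1) (P.v (p + 1)) with hD
  have hDc : m ≤ D.card + 2 := by
    have h1 := P.card_Nb H (P.c l) (P.v 1)
    have h2 : P.Nb (P.c l) (P.v 1) ⊆ D.image (· + 1) := by
      intro i hi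
      rw [mem_Nb] at hi
      have hne : i ≠ 1 := by rintro rfl; exact (G _).irrefl hi.2
      rw [Finset.mem_image]
      refine ⟨i - 1, ?_, by omega⟩
      rw [hD, Finset.mem_filter, Finset.mem_Ico, Nat.sub_add_cancel (by omega)]
      exact ⟨by omega, hi.2⟩
    have h3 := (Finset.card_le_card h2).trans Finset.card_image_le
    omega
  obtain ⟨w, hw⟩ : ∃ w, w = m / 16 + 4 := ⟨_, rfl⟩
  have hcl : ∀ p ∈ D, p = l ∨ p = k ∨ ¬ PL.Ev (P.c p) ∨ ¬ P.Ev (P.c p) ∨ (k ≤ p ∧ p < k + 2 * w) := by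
    intro p hp
    rw [hD, Finset.mem_filter, Finset.mem_Ico] at hp
    by_contra hno
    push Not at hno
    obtain ⟨hpl, hpk, eL, e0, hpw⟩ := hno
    have hLev : ∀ j, 1 ≤ j → j + 1 < 2 * m → j % 2 = 0 →
        (G (P.c p)).Adj (P.v (2 * m - 1)) (P.v j) := by
      intro j hj hj' hje
      exact (P.swapA_ev _ _ _ _ eL hj (by omega) (by omega)).2 (Nat.even_iff.2 hje)
    rcases lt_or_gt_of_ne hpk with hlt | hgt
    · exact Q.ca H hp.1.1 hlt hpl hp.2 (hLev k hk hk' hke)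
    · by_cases hpe : p % 2 = 0
      · exact Q.cb H hgt (by omega) hpl hp.2 (hLev p hp.1.1 (by omega) hpe)
      · have hpw' := hpw hgt.le
        have hap : (G P.s).Adj P.x (P.v (p - 1)) :=
          (hs _ (by omega) (by omega)).2 (Nat.even_iff.2 (by omega))
        have hbp : p + 1 < 2 * m → (G (P.c p)).Adj P.x (P.v (p + 1)) := fun h =>
          (e0 _ (by omega) h).2 (Nat.even_iff.2 (by omega))
        have hex : ∃ j ∈ Finset.Ico 1 w, k + 2 * j ≠ l ∧
            (P.swapA p (by omega) (by omega) hap hbp).Ev (P.c (k + 2 * j)) := by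
          by_contra hno
          push Not at hno
          have b1 := (P.swapA p (by omega) (by omega) hap hbp).G2 H
          have h1 : (((Finset.Ico 1 w).image (fun j => k + 2 * j)).erase l).card ≤
              (Finset.univ.filter fun c =>
                ¬ (P.swapA p (by omega) (by omega) hap hbp).Ev c).card := by
            apply Finset.card_le_card_of_injOn P.c
            · intro r hr
              rw [Finset.mem_coe, Finset.mem_erase, Finset.mem_image] at hr
              obtain ⟨hrl, j, hj, rfl⟩ := hr
              rw [Finset.mem_coe, Finset.mem_filter]
              exact ⟨Finset.mem_univ _, hno j hj hrl⟩
            · intro r hr r' hr' hrr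
              rw [Finset.mem_coe, Finset.mem_erase, Finset.mem_image] at hr hr'
              obtain ⟨_, j, hj, rfl⟩ := hr
              obtain ⟨_, j', hj', rfl⟩ := hr'
              rw [Finset.mem_Ico] at hj hj'
              exact P.cinj (by omega) (by omega) (by omega) (by omega) hrr
          have h2 := Finset.pred_card_le_card_erase
            (s := (Finset.Ico 1 w).image (fun j => k + 2 * j)) (a := l)
          rw [Finset.card_image_of_injective _ (fun a b h => by simpa using h), Nat.card_Ico] at h2
          omega
        obtain ⟨j, hj, hjl, hjE⟩ := hex
        rw [Finset.mem_Ico] at hj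
        refine Q.ccc H (p := p) (r := k + 2 * j) (by omega) (by omega) (by omega) hpl hjl hp.2
          (hLev _ (by omega) (by omega) (by omega)) ?_
        exact (P.swapA_ev _ _ _ _ hjE hk (by omega) (by omega)).2 (Nat.even_iff.2 hke)
  have hinj : ∀ F : Finset C, (D.filter fun p => P.c p ∈ F).card ≤ F.card := by
    intro F
    apply Finset.card_le_card_of_injOn P.c
    · intro p hp
      rw [Finset.mem_coe, Finset.mem_filter] at hp
      exact hp.2
    · intro i hi j hj hij
      rw [Finset.mem_coe, Finset.mem_filter, hD, Finset.mem_filter, Finset.mem_Ico] at hi hj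
      exact P.cinj (by omega) (by omega) (by omega) (by omega) hij
  have i1 := hinj (Finset.univ.filter fun c => ¬ PL.Ev c)
  have i2 := hinj (Finset.univ.filter fun c => ¬ P.Ev c)
  set D1 := D.filter fun p => P.c p ∈ (Finset.univ.filter fun c => ¬ PL.Ev c) with hD1
  set D2 := D.filter fun p => P.c p ∈ (Finset.univ.filter fun c => ¬ P.Ev c) with hD2
  have hcov : D ⊆ {l, k} ∪ (D1 ∪ (D2 ∪ Finset.Ico k (k + 2 * w))) := by
    intro p hp
    simp only [hD1, hD2, Finset.mem_union, Finset.mem_insert, Finset.mem_singleton,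
      Finset.mem_filter, Finset.mem_univ, true_and, Finset.mem_Ico]
    rcases hcl p hp with h | h | h | h | h
    · tauto
    · tauto
    · exact Or.inr (Or.inl ⟨hp, h⟩)
    · exact Or.inr (Or.inr (Or.inl ⟨hp, h⟩))
    · exact Or.inr (Or.inr (Or.inr h))
  have c1 := (Finset.card_le_card hcov).trans (Finset.card_union_le _ _)
  have c2 := Finset.card_union_le D1 (D2 ∪ Finset.Ico k (k + 2 * w))
  have c3 := Finset.card_union_le D2 (Finset.Ico k (k + 2 * w))
  have c4 : ({l, k} : Finset ℕ).card ≤ 2 := Finset.card_le_two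
  rw [Nat.card_Ico] at c3
  omega

theorem step1s (H : Hyp G m) (P : PS G m) (hs : P.Ev P.s) (c : C) : P.Ev c := by
  by_contra hc
  obtain ⟨q, hq1, hq2, hqo, hx⟩ := P.odd_of_not_ev H hc
  rcases P.csurj c with rfl | ⟨k, hk1, hk2, rfl⟩
  · exact hc hs
  by_cases hke : Even k
  · exact P.core H hs hk1 hk2 hke hq1 hq2 hqo hx
  · rw [Nat.even_iff] at hke
    rw [Nat.odd_iff] at hqo
    refine P.rev.core H ((P.ev_rev _).2 hs) (k := 2 * m - 1 - k) (q := 2 * m - q) (by omega)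
      (by omega) (Nat.even_iff.2 (by omega)) (by omega) (by omega) (Nat.odd_iff.2 (by omega)) ?_
    change (G (P.c (2 * m - 1 - (2 * m - 1 - k)))).Adj P.x (P.v (2 * m - (2 * m - q)))
    rw [show 2 * m - 1 - (2 * m - 1 - k) = k by omega, show 2 * m - (2 * m - q) = q by omega]
    exact hx

theorem step1 (H : Hyp G m) (P : PS G m) (c : C) : P.Ev c := by
  have hbig := H.big
  have hs : P.Ev P.s := by
    have g := P.G1 H
    obtain ⟨p, hp⟩ : P.Od.Nonempty := by rw [← Finset.card_pos]; omega
    rw [mem_Od] at hp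
    obtain ⟨_, hpo, hpr, hpE⟩ := hp
    have := (P.ro hpr).step1s H ((P.ev_ro_odd hpr hpo _).2 hpE) P.s
    exact (P.ev_ro_odd hpr hpo _).1 this
  exact P.step1s H hs c

theorem caseB (H : Hyp G m) (P : PS G m) : ∃ A : Set V, A.ncard = m + 1 ∧
    ∀ c, ∀ x ∈ A, ∀ y ∈ A, ¬ (G c).Adj x y := by
  have hbig := H.big
  have hE := P.step1 H
  set O := (Finset.Ico 1 (2 * m)).filter (fun i => ¬ Even i) with hO
  have hOc : O.card = m := by
    have h1 := Finset.card_filter_add_card_filter_not (s := Finset.Ico 1 (2 * m)) (fun i => Even i)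
    have h2 : ((Finset.Ico 1 (2 * m)).filter fun i => Even i).card = m - 1 := by
      have h2 := card_evs m
      rw [evs] at h2
      convert h2
    have h3 : (Finset.Ico 1 (2 * m)).card = 2 * m - 1 := Nat.card_Ico _ _
    have h4 : O.card = ((Finset.Ico 1 (2 * m)).filter (fun i => ¬ Even i)).card := rfl
    omega
  have hxo : ∀ c, ∀ i ∈ O, ¬ (G c).Adj P.x (P.v i) := by
    intro c i hi h
    rw [hO, Finset.mem_filter, Finset.mem_Ico] at hi
    exact hi.2 ((hE c i hi.1.1 hi.1.2).1 h)
  have hoo3 : ∀ c, ∀ i ∈ O, ∀ j ∈ O, 2 ≤ i → ¬ (G c).Adj (P.v i) (P.v j) := by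
    intro c i hi j hj hi2 h
    rw [hO, Finset.mem_filter, Finset.mem_Ico] at hi hj
    have hne : j ≠ i := by rintro rfl; exact (G _).irrefl h
    have hie := hi.2
    rw [Nat.even_iff] at hie
    have ha : (G P.s).Adj P.x (P.v (i - 1)) :=
      (hE _ _ (by omega) (by omega)).2 (Nat.even_iff.2 (by omega))
    have hb : i + 1 < 2 * m → (G (P.c i)).Adj P.x (P.v (i + 1)) := fun h =>
      (hE _ _ (by omega) h).2 (Nat.even_iff.2 (by omega))
    have hE' := (P.swapA i hi2 hi.1.2 ha hb).step1 H c
    exact hj.2 ((P.swapA_ev _ _ _ _ hE' hj.1.1 hj.1.2 hne).1 h)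
  have hoo : ∀ c, ∀ i ∈ O, ∀ j ∈ O, ¬ (G c).Adj (P.v i) (P.v j) := by
    intro c i hi j hj h
    by_cases hi2 : 2 ≤ i
    · exact hoo3 c i hi j hj hi2 h
    · by_cases hj2 : 2 ≤ j
      · exact hoo3 c j hj i hi hj2 h.symm
      · have hi' := hi
        have hj' := hj
        rw [hO, Finset.mem_filter, Finset.mem_Ico] at hi' hj'
        have : i = j := by omega
        subst this
        exact (G _).irrefl h
  refine ⟨((insert P.x (O.image P.v) : Finset V) : Set V), ?_, ?_⟩
  · rw [Set.ncard_coe_finset, Finset.card_insert_of_notMem, Finset.card_image_of_injOn, hOc]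
    · intro i hi j hj hij
      rw [Finset.mem_coe, hO, Finset.mem_filter, Finset.mem_Ico] at hi hj
      exact P.vinj hi.1.1 hi.1.2 hj.1.1 hj.1.2 hij
    · intro h
      rw [Finset.mem_image] at h
      obtain ⟨i, hi, hi'⟩ := h
      rw [hO, Finset.mem_filter, Finset.mem_Ico] at hi
      exact P.xne hi.1.1 hi.1.2 hi'
  · intro c y hy z hz
    rw [Finset.mem_coe, Finset.mem_insert, Finset.mem_image] at hy hz
    rcases hy with rfl | ⟨i, hi, rfl⟩
    · rcases hz with rfl | ⟨j, hj, rfl⟩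
      · exact (G _).irrefl
      · exact hxo c j hj
    · rcases hz with rfl | ⟨j, hj, rfl⟩
      · exact fun h => hxo c i hi h.symm
      · exact hoo c i hi j hj

end PS
end StepOne


section StepA
open scoped Classical
variable {V C : Type} {G : C → SimpleGraph V} {m : ℕ}

theorem Pth.index {u w : V} {S : Multiset V} {K : Multiset C} (p : Pth G u w S K) (c₀ : C) :
    ∃ (v : ℕ → V) (c : ℕ → C) (k : ℕ), 1 ≤ k ∧ v 1 = u ∧ v k = w ∧ S = Rg v 1 (k + 1) ∧
      K = Rg c 1 k ∧ ∀ i, 1 ≤ i → i < k → (G (c i)).Adj (v i) (v (i + 1)) := by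
  induction p with
  | single u =>
    exact ⟨fun _ => u, fun _ => c₀, 1, le_refl _, rfl, rfl, by rw [Rg.one], by rw [Rg.nil],
      fun i h1 h2 => by omega⟩
  | @cons u u' w S K d h p ih =>
    obtain ⟨v, c, k, hk, h1, h2, h3, h4, h5⟩ := ih
    have sh : ∀ {α : Type} (f : ℕ → α) (a : α) (b : ℕ), 1 ≤ b →
        Rg (fun i => if i ≤ 1 then a else f (i - 1)) 1 (b + 1) = {a} + Rg f 1 b := by
      intro α f a b hb
      rw [Rg.first _ (by omega)]
      congr 1
      rw [Rg, Rg, ← Finset.sum_Ico_add' _ 1 b 1]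
      apply Finset.sum_congr rfl
      intro i hi
      rw [Finset.mem_Ico] at hi
      rw [if_neg (by omega)]
      rfl
    refine ⟨fun i => if i ≤ 1 then u else v (i - 1), fun i => if i ≤ 1 then d else c (i - 1),
      k + 1, by omega, rfl, ?_, ?_, ?_, ?_⟩
    · simp only [if_neg (show ¬ (k + 1 ≤ 1) by omega)]
      exact h2
    · rw [sh _ _ _ (by omega), h3]
    · rw [sh _ _ _ (by omega), h4]
    · intro i hi hi'
      by_cases h : i = 1
      · subst h
        simpa [h1] using ‹(G d).Adj u u'›
      · have := h5 (i - 1) (by omega) (by omega)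
        simp only [if_neg (show ¬ (i ≤ 1) by omega), if_neg (show ¬ (i + 1 ≤ 1) by omega)]
        rw [show i - 1 + 1 = i by omega] at this
        simpa using this

theorem Rg.card {α : Type} (f : ℕ → α) (a b : ℕ) : Multiset.card (Rg f a b) = b - a := by
  simp [Rg]

theorem Pth.cardSK {u w : V} {S : Multiset V} {K : Multiset C} (p : Pth G u w S K) :
    Multiset.card S = Multiset.card K + 1 := by
  induction p with
  | single u => simp
  | cons d h p ih => simp [ih]

/-- Rotation of a closed path. -/
theorem Pth.rotate {u w : V} {S : Multiset V} {K : Multiset C} (p : Pth G u w S K) (e : C)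
    (he : (G e).Adj w u) :
    (∀ y ∈ S, ∃ w' d K', Pth G y w' S K' ∧ (G d).Adj w' y ∧ {d} + K' = {e} + K) ∧
    (∀ d ∈ {e} + K, ∃ y w' K', Pth G y w' S K' ∧ (G d).Adj w' y ∧ {d} + K' = {e} + K) := by
  obtain ⟨v, c, k, hk, h1, h2, h3, h4, h5⟩ := p.index e
  have key : ∀ i, 1 ≤ i → i < k → ∃ K', Pth G (v (i + 1)) (v i) S K' ∧
      (G (c i)).Adj (v i) (v (i + 1)) ∧ {c i} + K' = {e} + K := by
    intro i hi hik
    refine ⟨Rg c (i + 1) k + {e} + Rg c 1 i, ?_, h5 i hi hik, ?_⟩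
    · have a1 := Pth.blk v c (a := i + 1) (b := k) (by omega) (fun j hj hj' => h5 j (by omega) hj')
      have a2 := Pth.blk v c (a := 1) (b := i) (by omega) (fun j hj hj' => h5 j hj (by omega))
      have := a1.join e (by rw [h2, h1]; exact he) a2
      rwa [add_comm (Rg v (i + 1) (k + 1)), ← Rg.split v (by omega) (by omega), ← h3] at this
    · rw [h4, Rg.split c hi (by omega : i ≤ k), Rg.first c hik]
      abel
  constructor
  · intro y hy
    rw [h3, Rg.mem_iff] at hy
    obtain ⟨i, hi, hi', rfl⟩ := hy
    by_cases h : i = 1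
    · subst h
      exact ⟨w, e, K, by rw [h1]; exact p, by rw [h1]; exact he, rfl⟩
    · obtain ⟨K', q, hq, hK⟩ := key (i - 1) (by omega) (by omega)
      rw [show i - 1 + 1 = i by omega] at q hq
      exact ⟨_, _, K', q, hq, hK⟩
  · intro d hd
    rw [Multiset.mem_add, Multiset.mem_singleton] at hd
    rcases hd with rfl | hd
    · exact ⟨u, w, K, p, he, rfl⟩
    · rw [h4, Rg.mem_iff] at hd
      obtain ⟨i, hi, hi', rfl⟩ := hd
      obtain ⟨K', q, hq, hK⟩ := key i hi hi'
      exact ⟨_, _, K', q, hq, hK⟩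

variable [Fintype V] [Fintype C]

theorem eq_univ_val {α : Type} [Fintype α] {M : Multiset α} (h : M.Nodup)
    (hc : Fintype.card α ≤ Multiset.card M) : M = Finset.univ.val := by
  apply Multiset.eq_of_le_of_card_le
  · exact (Multiset.le_iff_subset h).2 (fun a _ => Finset.mem_univ a)
  · exact hc

theorem exists_free {α : Type} [Fintype α] {M : Multiset α}
    (hc : Multiset.card M < Fintype.card α) : ∃ a, a ∉ M := by
  by_contra hcon
  push Not at hcon
  have : (Finset.univ : Finset α).card ≤ M.toFinset.card :=
    Finset.card_le_card (fun a _ => Multiset.mem_toFinset.2 (hcon a))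
  have h2 := Multiset.toFinset_card_le M
  rw [Finset.card_univ] at this
  omega

theorem nocross_eq (H : Hyp G m) {A : Finset V} {c : C} (h1 : ∃ a, a ∈ A) (h2 : ∃ a, a ∉ A)
    (h : ∀ y ∈ A, ∀ z, z ∉ A → ¬ (G c).Adj z y) :
    A.card = m ∧ ∀ x y, (G c).Adj x y ↔ x ≠ y ∧ (x ∈ A ↔ y ∈ A) := by
  have hbig := H.big
  have b1 : ∀ y ∈ A, (Finset.univ.filter fun z => (G c).Adj y z) ⊆ A.erase y := by
    intro y hy z hz
    rw [Finset.mem_filter] at hz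
    rw [Finset.mem_erase]
    refine ⟨hz.2.ne.symm, ?_⟩
    by_contra hzA
    exact h y hy z hzA hz.2.symm
  have b2 : ∀ y, y ∉ A → (Finset.univ.filter fun z => (G c).Adj y z) ⊆ Aᶜ.erase y := by
    intro y hy z hz
    rw [Finset.mem_filter] at hz
    rw [Finset.mem_erase, Finset.mem_compl]
    refine ⟨hz.2.ne.symm, ?_⟩
    intro hzA
    exact h z hzA y hy hz.2
  have e1 : ∀ y ∈ A, (A.erase y).card + 1 = A.card := fun y hy => Finset.card_erase_add_one hy
  have e2 : ∀ y, y ∉ A → (Aᶜ.erase y).card + 1 = Aᶜ.card :=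
    fun y hy => Finset.card_erase_add_one (Finset.mem_compl.2 hy)
  have hcc : Aᶜ.card + A.card = 2 * m := by
    rw [← H.cardV]; exact Finset.card_compl_add_card A
  obtain ⟨a, ha⟩ := h1
  obtain ⟨z, hz⟩ := h2
  have hA : A.card = m := by
    have := Finset.card_le_card (b1 a ha)
    have := Finset.card_le_card (b2 z hz)
    have := H.dg c a
    have := H.dg c z
    have := e1 a ha
    have := e2 z hz
    omega
  refine ⟨hA, ?_⟩
  intro x y
  constructor
  · intro hxy
    refine ⟨hxy.ne, ?_⟩
    by_cases hx : x ∈ A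
    · simp only [hx, true_iff]
      by_contra hy
      exact h x hx y hy hxy.symm
    · simp only [hx, false_iff]
      intro hy
      exact h y hy x hx hxy
  · rintro ⟨hne, hiff⟩
    by_cases hx : x ∈ A
    · have heq : (Finset.univ.filter fun z => (G c).Adj x z) = A.erase x := by
        apply Finset.eq_of_subset_of_card_le (b1 x hx)
        have := e1 x hx
        have := H.dg c x
        omega
      have : y ∈ A.erase x := Finset.mem_erase.2 ⟨hne.symm, hiff.1 hx⟩
      rw [← heq, Finset.mem_filter] at this
      exact this.2
    · have heq : (Finset.univ.filter fun z => (G c).Adj x z) = Aᶜ.erase x := by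
        apply Finset.eq_of_subset_of_card_le (b2 x hx)
        have := e2 x hx
        have := H.dg c x
        omega
      have : y ∈ Aᶜ.erase x :=
        Finset.mem_erase.2 ⟨hne.symm, Finset.mem_compl.2 (fun hy => hx (hiff.2 hy))⟩
      rw [← heq, Finset.mem_filter] at this
      exact this.2

/-- Every rainbow path has at most `p` vertices. -/
def MaxP (G : C → SimpleGraph V) (p : ℕ) : Prop :=
  ∀ u w S K, Pth G u w S K → S.Nodup → K.Nodup → Multiset.card S ≤ p

theorem cyc_nocross {p : ℕ} (hM : MaxP G p) {u w : V} {S : Multiset V} {K : Multiset C}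
    (P : Pth G u w S K) {e : C} (he : (G e).Adj w u) (hS : S.Nodup) (hK : ({e} + K).Nodup)
    (hp : Multiset.card S = p) {f : C} (hf : f ∉ {e} + K) :
    ∀ y ∈ S.toFinset, ∀ z, z ∉ S.toFinset → ¬ (G f).Adj z y := by
  intro y hy z hz hzy
  rw [Multiset.mem_toFinset] at hy hz
  obtain ⟨w', d, K', q, _, hK'⟩ := (P.rotate e he).1 y hy
  have q' := Pth.cons f hzy q
  have h1 : ({z} + S).Nodup := by
    rw [Multiset.singleton_add]; exact Multiset.nodup_cons.2 ⟨hz, hS⟩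
  rw [← hK', Multiset.singleton_add] at hK hf
  have h2 : ({f} + K').Nodup := by
    rw [Multiset.singleton_add]
    exact Multiset.nodup_cons.2 ⟨fun h => hf (Multiset.mem_cons_of_mem h),
      (Multiset.nodup_cons.1 hK).2⟩
  have := hM _ _ _ _ q' h1 h2
  rw [Multiset.card_add, Multiset.card_singleton] at this
  omega

theorem cyc_done (H : Hyp G m) {p : ℕ} (hM : MaxP G p) {u w : V} {S : Multiset V}
    {K : Multiset C} (P : Pth G u w S K) {e : C} (he : (G e).Adj w u) (hS : S.Nodup)
    (hK : ({e} + K).Nodup) (hp : Multiset.card S = p) (hpm : p + 2 ≤ 2 * m) :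
    ∃ A : Set V, A.ncard = m ∧ ∀ c x y, (G c).Adj x y ↔ x ≠ y ∧ (x ∈ A ↔ y ∈ A) := by
  have hcS := P.cardSK
  have hcV := H.cardV
  have hcC := H.cardC
  obtain ⟨f, hf⟩ : ∃ f, f ∉ {e} + K := exists_free (by
    rw [Multiset.card_add, Multiset.card_singleton]; omega)
  have i1 : ∃ a, a ∈ S.toFinset := by
    have : 0 < Multiset.card S := by omega
    obtain ⟨a, ha⟩ := Multiset.card_pos_iff_exists_mem.1 this
    exact ⟨a, Multiset.mem_toFinset.2 ha⟩
  have i2 : ∃ a, a ∉ S.toFinset := by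
    obtain ⟨a, ha⟩ := exists_free (M := S) (by omega)
    exact ⟨a, fun h => ha (Multiset.mem_toFinset.1 h)⟩
  have hfree := nocross_eq H i1 i2 (cyc_nocross hM P he hS hK hp hf)
  refine ⟨(S.toFinset : Set V), ?_, ?_⟩
  · rw [Set.ncard_coe_finset]; exact hfree.1
  intro c
  simp only [Finset.mem_coe]
  by_cases hc : c ∈ {e} + K
  · obtain ⟨y, w', K', q, hq, hK'⟩ := (P.rotate e he).2 c hc
    have hadj : (G f).Adj w' y := by
      rw [hfree.2]
      refine ⟨hq.ne, ?_⟩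
      obtain ⟨v, c, k, hk, h1, h2, h3, h4, h5⟩ := q.index e
      have j1 : y ∈ S.toFinset := by
        rw [Multiset.mem_toFinset, h3, Rg.mem_iff]; exact ⟨1, le_refl _, by omega, h1⟩
      have j2 : w' ∈ S.toFinset := by
        rw [Multiset.mem_toFinset, h3, Rg.mem_iff]; exact ⟨k, hk, by omega, h2⟩
      simp [j1, j2]
    rw [← hK', Multiset.singleton_add] at hK hf
    rw [Multiset.nodup_cons] at hK
    rw [Multiset.mem_cons] at hf
    push Not at hf
    refine (nocross_eq H i1 i2 (cyc_nocross hM q hadj hS ?_ hp ?_)).2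
    · rw [Multiset.singleton_add]; exact Multiset.nodup_cons.2 ⟨hf.2, hK.2⟩
    · rw [Multiset.singleton_add, Multiset.mem_cons]
      rintro (h | h)
      · exact hf.1 h.symm
      · exact hK.1 h
  · exact (nocross_eq H i1 i2 (cyc_nocross hM P he hS hK hp hc)).2

theorem deg_ix (H : Hyp G m) {S : Multiset V} {v : ℕ → V} {k : ℕ} (hS : S = Rg v 1 (k + 1))
    {c : C} {u : V} (h : ∀ y, (G c).Adj u y → y ∈ S) :
    m ≤ ((Finset.Ico 1 (k + 1)).filter fun i => (G c).Adj u (v i)).card + 1 := by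
  have h1 := H.dg c u
  have h2 : (Finset.univ.filter fun y => (G c).Adj u y) ⊆
      ((Finset.Ico 1 (k + 1)).filter fun i => (G c).Adj u (v i)).image v := by
    intro y hy
    rw [Finset.mem_filter] at hy
    have := h y hy.2
    rw [hS, Rg.mem_iff] at this
    obtain ⟨i, hi, hi', rfl⟩ := this
    rw [Finset.mem_image]
    exact ⟨i, by rw [Finset.mem_filter, Finset.mem_Ico]; exact ⟨⟨hi, hi'⟩, hy.2⟩, rfl⟩
  have h3 := Finset.card_le_card h2
  have h4 := Finset.card_image_le (s := (Finset.Ico 1 (k + 1)).filter fun i => (G c).Adj u (v i))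
    (f := v)
  omega

theorem max_done (H : Hyp G m) {p : ℕ} (hM : MaxP G p) {u w : V} {S : Multiset V}
    {K : Multiset C} (P : Pth G u w S K) (hS : S.Nodup)
    (hK : K.Nodup) (hp : Multiset.card S = p) (hpm : p + 2 ≤ 2 * m) :
    ∃ A : Set V, A.ncard = m ∧ ∀ c x y, (G c).Adj x y ↔ x ≠ y ∧ (x ∈ A ↔ y ∈ A) := by
  have hcS := P.cardSK
  have hcV := H.cardV
  have hcC := H.cardC
  have hbig := H.big
  have ext : ∀ {u w : V}, Pth G u w S K → ∀ a, a ∉ K → ∀ y, (G a).Adj u y → y ∈ S := by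
    intro u w P a ha y hy
    by_contra hyS
    have := hM _ _ _ _ (Pth.cons a hy.symm P)
      (by rw [Multiset.singleton_add]; exact Multiset.nodup_cons.2 ⟨hyS, hS⟩)
      (by rw [Multiset.singleton_add]; exact Multiset.nodup_cons.2 ⟨ha, hK⟩)
    rw [Multiset.card_add, Multiset.card_singleton] at this
    omega
  obtain ⟨a, ha⟩ : ∃ a, a ∉ K := exists_free (by omega)
  obtain ⟨b, hb⟩ : ∃ b, b ∉ {a} + K := exists_free (by
    rw [Multiset.card_add, Multiset.card_singleton]; omega)
  rw [Multiset.singleton_add, Multiset.mem_cons] at hb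
  push Not at hb
  obtain ⟨v, c, k, hk, h1, h2, h3, h4, h5⟩ := P.index a
  have hkp : k = p := by rw [← hp, h3, Rg.card]; omega
  subst hkp
  have d1 := deg_ix H h3 (ext P a ha)
  have d2 := deg_ix H h3 (ext P.symm b hb.2)
  set T := (Finset.Ico 1 k).filter fun i => (G a).Adj u (v (i + 1)) with hT
  set U := (Finset.Ico 1 k).filter fun i => (G b).Adj w (v i) with hU
  have c1 : m ≤ T.card + 1 := by
    have : ((Finset.Ico 1 (k + 1)).filter fun i => (G a).Adj u (v i)) ⊆ T.image (· + 1) := by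
      intro i hi
      rw [Finset.mem_filter, Finset.mem_Ico] at hi
      have : i ≠ 1 := by
        rintro rfl
        rw [h1] at hi
        exact (G a).irrefl hi.2
      rw [Finset.mem_image]
      refine ⟨i - 1, ?_, by omega⟩
      rw [hT, Finset.mem_filter, Finset.mem_Ico, show i - 1 + 1 = i by omega]
      exact ⟨by omega, hi.2⟩
    have := Finset.card_le_card this
    have := Finset.card_image_le (s := T) (f := (· + 1))
    omega
  have c2 : m ≤ U.card + 1 := by
    have : ((Finset.Ico 1 (k + 1)).filter fun i => (G b).Adj w (v i)) ⊆ U := by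
      intro i hi
      rw [Finset.mem_filter, Finset.mem_Ico] at hi
      have : i ≠ k := by
        rintro rfl
        rw [h2] at hi
        exact (G b).irrefl hi.2
      rw [hU, Finset.mem_filter, Finset.mem_Ico]
      exact ⟨by omega, hi.2⟩
    have := Finset.card_le_card this
    omega
  obtain ⟨i, hi⟩ : (T ∩ U).Nonempty := by
    rw [← Finset.card_pos]
    have e1 := Finset.card_union_add_card_inter T U
    have e2 : (T ∪ U).card ≤ (Finset.Ico 1 k).card :=
      Finset.card_le_card (Finset.union_subset (Finset.filter_subset _ _)
        (Finset.filter_subset _ _))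
    rw [Nat.card_Ico] at e2
    omega
  rw [Finset.mem_inter, hT, hU, Finset.mem_filter, Finset.mem_filter, Finset.mem_Ico] at hi
  obtain ⟨⟨⟨hi1, hik⟩, hiT⟩, _, hiU⟩ := hi
  have a1 := Pth.blk v c (a := 1) (b := i) (by omega) (fun j hj hj' => h5 j hj (by omega))
  have a2 := Pth.blk v c (a := i + 1) (b := k) (by omega) (fun j hj hj' => h5 j (by omega) hj')
  have Q := a1.join b (by rw [h2]; exact hiU.symm) a2.symm
  rw [← Rg.split v (by omega) (by omega), ← h3, h1] at Q
  refine cyc_done H hM Q hiT.symm hS ?_ hp hpm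
  have hKe : K = {c i} + (Rg c 1 i + Rg c (i + 1) k) := by
    rw [h4, Rg.split c hi1 (by omega : i ≤ k), Rg.first c hik]
    abel
  have hsub : ∀ x, x ∈ Rg c 1 i + Rg c (i + 1) k → x ∈ K := by
    intro x hx
    rw [hKe, Multiset.mem_add]; exact Or.inr hx
  have hnd : (Rg c 1 i + Rg c (i + 1) k).Nodup := by
    rw [hKe, Multiset.singleton_add, Multiset.nodup_cons] at hK
    exact hK.2
  have : {a} + (Rg c 1 i + {b} + Rg c (i + 1) k) = a ::ₘ b ::ₘ (Rg c 1 i + Rg c (i + 1) k) := by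
    rw [← Multiset.singleton_add, ← Multiset.singleton_add]
    abel
  rw [this, Multiset.nodup_cons, Multiset.nodup_cons, Multiset.mem_cons]
  refine ⟨?_, fun h => hb.2 (hsub _ h), hnd⟩
  rintro (h | h)
  · exact hb.1 h.symm
  · exact ha (hsub _ h)

theorem main_dich (H : Hyp G m) :
    (∃ A : Set V, A.ncard = m ∧ ∀ c x y, (G c).Adj x y ↔ x ≠ y ∧ (x ∈ A ↔ y ∈ A)) ∨
    (∃ A : Set V, A.ncard = m + 1 ∧ ∀ c, ∀ x ∈ A, ∀ y ∈ A, ¬ (G c).Adj x y) := by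
  have hcV := H.cardV
  have hcC := H.cardC
  have hbig := H.big
  let Q : ℕ → Prop := fun k => ∃ u w S K, Pth G u w S K ∧ S.Nodup ∧ K.Nodup ∧
    Multiset.card S = k
  have bd : ∀ k, Q k → k ≤ 2 * m := by
    rintro k ⟨u, w, S, K, _, hS, _, hk⟩
    have : S.toFinset.card ≤ Fintype.card V := Finset.card_le_univ _
    rw [Multiset.toFinset_card_of_nodup hS] at this
    omega
  have hV : Nonempty V := Fintype.card_pos_iff.1 (by omega)
  have q1 : Q 1 := ⟨hV.some, hV.some, {hV.some}, 0, Pth.single _, Multiset.nodup_singleton _,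
    Multiset.nodup_zero, by simp⟩
  have qp : Q (Nat.findGreatest Q (2 * m)) := Nat.findGreatest_spec (m := 1) (by omega) q1
  set p := Nat.findGreatest Q (2 * m) with hpdef
  have hM : MaxP G p := fun u w S K P hS hK =>
    Nat.le_findGreatest (bd _ ⟨u, w, S, K, P, hS, hK, rfl⟩) ⟨u, w, S, K, P, hS, hK, rfl⟩
  have hp2 := bd p qp
  obtain ⟨u, w, S, K, P, hS, hK, hp⟩ := qp
  have hcS := P.cardSK
  by_cases c1 : p + 2 ≤ 2 * m
  · exact Or.inl (max_done H hM P hS hK hp c1)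
  by_cases c2 : p = 2 * m
  · exfalso
    have e1 := eq_univ_val hS (by omega)
    have e2 := eq_univ_val hK (by omega)
    rw [e1, e2] at P
    exact H.noham _ _ P
  right
  obtain ⟨x, hx⟩ := exists_free (M := S) (by omega)
  obtain ⟨s, hs⟩ := exists_free (M := K) (by omega)
  obtain ⟨v, c, k, hk, h1, h2, h3, h4, h5⟩ := P.index s
  have hkp : k = 2 * m - 1 := by
    have : k = p := by rw [← hp, h3, Rg.card]; omega
    omega
  have hP : PS G m := by
    refine ⟨v, c, x, s, fun i hi hi' => h5 i hi (by omega), ?_, ?_⟩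
    · rw [show 2 * m = k + 1 by omega, ← h3]
      apply eq_univ_val
      · rw [Multiset.singleton_add]; exact Multiset.nodup_cons.2 ⟨hx, hS⟩
      · rw [Multiset.card_add, Multiset.card_singleton]; omega
    · rw [← hkp, ← h4]
      apply eq_univ_val
      · rw [Multiset.singleton_add]; exact Multiset.nodup_cons.2 ⟨hs, hK⟩
      · rw [Multiset.card_add, Multiset.card_singleton]; omega
  exact hP.caseB H

theorem deg_eq (F : SimpleGraph V) (u : V) :
    deg F u = (Finset.univ.filter fun y => F.Adj u y).card := by
  rw [deg, ← Set.ncard_coe_finset]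
  congr 1
  ext y
  simp

end StepA

/-- Theorem 5 (i): for large even `n`, a collection of `n-1` graphs with `δ(𝒢) ≥ (n-3)/2`
and no transversal Hamilton path is either `ℋ_{n-1}^0` (each graph is `2K_{n/2}` on a common
equitable partition) or has a common independent set of size `n/2 + 1`. -/
theorem stmt_18 :
    ∃ n₀ : ℕ, ∀ n : ℕ, n₀ ≤ n → Even n →
      ∀ (V : Type) [Fintype V] [DecidableEq V] (Gs : Fin (n - 1) → SimpleGraph V),
        Fintype.card V = n →
        (∀ i v, n - 3 ≤ 2 * deg (Gs i) v) →
        ¬ HasTransHamPath Gs →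
        ((∃ A : Set V, A.ncard = n / 2 ∧
            ∀ i x y, (Gs i).Adj x y ↔ x ≠ y ∧ (x ∈ A ↔ y ∈ A))
          ∨ (∃ A : Set V, A.ncard = n / 2 + 1 ∧
              ∀ i, ∀ x ∈ A, ∀ y ∈ A, ¬ (Gs i).Adj x y)) := by
  refine ⟨2000000000000, ?_⟩
  intro n hn he V _ _ Gs hV hdeg hno
  obtain ⟨m, rfl⟩ := he
  have H : Hyp Gs m := by
    refine ⟨by omega, by rw [Fintype.card_fin]; omega, by omega, ?_, fun u w P => hno P.ham⟩
    intro c u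
    have h1 := hdeg c u
    rw [← deg_eq]
    omega
  rw [show (m + m) / 2 = m by omega]
  exact main_dich H
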